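/- With the hierarchical index structure, known nonnegative constants r and s, and independent Poisson data X (means r_{(·)}λ_{(·)}) and Y (means s_{(·)}λ_{(·)}) as above, let π be a probability measure on (0,∞)^{I_D} (a prior for λ) with ∫ λ_{i_1,…,i_D} dπ(λ) < ∞ for all (i_1,…,i_D) ∈ I_D, and let p̂^{(π)}(y; X) = ∫ p(y|λ')·p(X|λ') dπ(λ') / ∫ p(X|λ') dπ(λ') be the Bayesian predictive density for Y given X. For each index (i_1,…,i_d), let t_{(i_1,…,i_d)} : [0,1] → [0,∞) be nondecreasing and continuously differentiable with t_{(i_1,…,i_d)}(0) = r_{(i_1,…,i_d)} and t_{(i_1,…,i_d)}(1) = s_{(i_1,…,i_d)} + r_{(i_1,…,i_d)}; for θ ∈ [0,1] let Z(θ) be the collection of independent Poisson variables with means t_{(i_1,…,i_d)}(θ)·λ_{(i_1,…,i_d)}, and let λ̂_{(i_1,…,i_d)}(Z(θ)) = E_π[λ_{(i_1,…,i_d)} | Z(θ)] be the posterior mean under π. Then, assuming all expectations involved are finite, E_λ[log(p(Y|λ)/p̂^{(π)}(Y; X))] = ∫_0^1 E_λ[Σ_{d=0}^D Σ_{(i_1,…,i_d)∈I_d}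 (d/dθ)t_{(i_1,…,i_d)}(θ)·λ_{(i_1,…,i_d)}·(λ̂_{(i_1,…,i_d)}(Z(θ))/λ_{(i_1,…,i_d)} − 1 − log(λ̂_{(i_1,…,i_d)}(Z(θ))/λ_{(i_1,…,i_d)}))] dθ; that is, the Kullback–Leibler risk of the Bayesian predictive density equals the integral over θ of the corresponding entropy-loss risks of the posterior-mean estimators. -/

import Mathlib

open scoped BigOperators ENNReal

/-- The Poisson(μ) probability of the value `k`. -/
noncomputable def poissonPmf (mu : ℝ) (k : ℕ) : ℝ :=
  mu ^ k * Real.exp (-mu) / (Nat.factorial k)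

/-- The index set I_d = Π_{d'=1}^d {1,…,n_{d'}} of level d of the hierarchy. -/
abbrev Idx (n : ℕ → ℕ) (d : ℕ) := (k : Fin d) → Fin (n (k.val + 1))

/-- Restriction of a level-e index to its first d coordinates. -/
def resIdx (n : ℕ → ℕ) {d e : ℕ} (h : d ≤ e) (j : Idx n e) : Idx n d :=
  fun k => j (Fin.castLE h k)

/-- Marginal sum v_{(i_1,…,i_d)} = Σ over extensions j ∈ I_D of i of v_j. -/
noncomputable def marg (n : ℕ → ℕ) (D : ℕ) (v : Idx n D → ℝ) {d : ℕ} (h : d ≤ D)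
    (i : Idx n d) : ℝ :=
  ∑ j : Idx n D, if resIdx n h j = i then v j else 0

/-- The sample space: one observation X_{(i_1,…,i_d)} ∈ ℕ for each level d = 0,…,D
and each index in I_d. -/
abbrev Obs (n : ℕ → ℕ) (D : ℕ) := (d : Fin (D + 1)) → Idx n d.val → ℕ

/-- Joint pmf of the hierarchical observations: all X_{(i_1,…,i_d)} independent,
X_{(i_1,…,i_d)} ~ Po(λ_{(i_1,…,i_d)}). -/
noncomputable def hierPmf (n : ℕ → ℕ) (D : ℕ) (lam : Idx n D → ℝ) (X : Obs n D) : ℝ :=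
  ∏ d : Fin (D + 1), ∏ i : Idx n d.val,
    poissonPmf (marg n D lam (Nat.lt_succ_iff.mp d.isLt) i) (X d i)

/-- X̃_{(i_1,…,i_d,+)}(D') = Σ_{d'=d}^D Σ_{extensions j ∈ I_{d'} of i} X̃_{(j)}(D'),
where X̃_{(j)}(D') = X_{(j)} if the level of j is ≥ D' and 0 otherwise. -/
def plusSum (n : ℕ → ℕ) (D : ℕ) (X : Obs n D) (D' : ℕ) {d : ℕ} (hd : d ≤ D)
    (i : Idx n d) : ℕ :=
  ∑ d' : Fin (D + 1), if h : d ≤ d'.val then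
    ∑ j : Idx n d'.val, if resIdx n h j = i ∧ D' ≤ d'.val then X d' j else 0
  else 0

/-- The generalized Bayes estimator λ̂^{(a)}(X(D')) under the prior with exponents a,
based on the data at levels D', D'+1, …, D. Its (i_1,…,i_D)-component is
((X̃_{(+)}(D') + a_0)/(1+D−D'))·Π_{d=1}^D (X̃_{(i_1,…,i_d,+)}(D') + a_d) /
(Σ_{i_d'} X̃_{(i_1,…,i_{d−1},i_d',+)}(D') + n_d a_d). -/
noncomputable def hierBayes (n : ℕ → ℕ) (D : ℕ) (a : ℕ → ℝ) (D' : ℕ) (X : Obs n D)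
    (j : Idx n D) : ℝ :=
  (((plusSum n D X D' (Nat.zero_le D) (fun k => k.elim0) : ℕ) : ℝ) + a 0) /
      (1 + (D : ℝ) - (D' : ℝ)) *
    ∏ d : Fin D,
      (((plusSum n D X D' d.isLt (resIdx n d.isLt j) : ℕ) : ℝ) + a (d.val + 1)) /
        ((∑ i2 : Idx n (d.val + 1),
            if resIdx n (Nat.le_succ d.val) i2 = resIdx n (le_of_lt d.isLt) j
            then ((plusSum n D X D' d.isLt i2 : ℕ) : ℝ) else 0) +
          (n (d.val + 1) : ℝ) * a (d.val + 1))

/-- Entropy loss L̃^KL(δ, λ) = Σ_{d=0}^D Σ_{i ∈ I_d}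
λ_{(i)}·(δ_{(i)}/λ_{(i)} − 1 − log(δ_{(i)}/λ_{(i)})). -/
noncomputable def hierLoss (n : ℕ → ℕ) (D : ℕ) (δ : Idx n D → ℝ) (lam : Idx n D → ℝ) : ℝ :=
  ∑ d : Fin (D + 1), ∑ i : Idx n d.val,
    marg n D lam (Nat.lt_succ_iff.mp d.isLt) i *
      (marg n D δ (Nat.lt_succ_iff.mp d.isLt) i / marg n D lam (Nat.lt_succ_iff.mp d.isLt) i
        - 1 -
        Real.log (marg n D δ (Nat.lt_succ_iff.mp d.isLt) i /
          marg n D lam (Nat.lt_succ_iff.mp d.isLt) i))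

/-- Entropy risk R̃(δ, λ) of an estimator δ of λ based on X, valued in [0,∞]. -/
noncomputable def hierRisk (n : ℕ → ℕ) (D : ℕ) (δ : Obs n D → Idx n D → ℝ)
    (lam : Idx n D → ℝ) : ℝ≥0∞ :=
  ∑' X : Obs n D, ENNReal.ofReal (hierLoss n D (δ X) lam * hierPmf n D lam X)

/-- Joint pmf of a collection of independent Poisson observations with means
c_{(i_1,…,i_d)}·λ_{(i_1,…,i_d)} (Poisson(0) is the point mass at 0). -/
noncomputable def scaledPmf (n : ℕ → ℕ) (D : ℕ) (c : (d : Fin (D + 1)) → Idx n d.val → ℝ)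
    (lam : Idx n D → ℝ) (z : Obs n D) : ℝ :=
  ∏ d : Fin (D + 1), ∏ i : Idx n d.val,
    poissonPmf (c d i * marg n D lam (Nat.lt_succ_iff.mp d.isLt) i) (z d i)

/-- The Bayesian predictive density p̂^{(π)}(y; X) for Y (scale s) given X (scale r),
under the prior π. -/
noncomputable def predDens (n : ℕ → ℕ) (D : ℕ) (π : MeasureTheory.Measure (Idx n D → ℝ))
    (r s : (d : Fin (D + 1)) → Idx n d.val → ℝ) (X y : Obs n D) : ℝ :=
  (∫ l, scaledPmf n D s l y * scaledPmf n D r l X ∂π) / ∫ l, scaledPmf n D r l X ∂π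

/-- The posterior mean λ̂_{(i_1,…,i_d)}(z) = E_π[λ_{(i_1,…,i_d)} | z] when z is the
collection of Poisson observations with scale function c. -/
noncomputable def postMean (n : ℕ → ℕ) (D : ℕ) (π : MeasureTheory.Measure (Idx n D → ℝ))
    (c : (d : Fin (D + 1)) → Idx n d.val → ℝ) (z : Obs n D) (d : Fin (D + 1))
    (i : Idx n d.val) : ℝ :=
  (∫ l, marg n D l (Nat.lt_succ_iff.mp d.isLt) i * scaledPmf n D c l z ∂π) /
    ∫ l, scaledPmf n D c l z ∂π

/-- The entropy-loss risk, at interpolation time θ, of the posterior-mean estimators: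
E_λ[Σ_{d,i} t'_{(i)}(θ)·λ_{(i)}·(λ̂_{(i)}(Z(θ))/λ_{(i)} − 1 − log(λ̂_{(i)}(Z(θ))/λ_{(i)}))],
where Z(θ) has independent Poisson components with means t_{(i)}(θ)·λ_{(i)}. -/
noncomputable def thetaRisk (n : ℕ → ℕ) (D : ℕ) (π : MeasureTheory.Measure (Idx n D → ℝ))
    (lam : Idx n D → ℝ) (t t' : (d : Fin (D + 1)) → Idx n d.val → ℝ → ℝ) (θ : ℝ) : ℝ :=
  ∑' z : Obs n D,
    scaledPmf n D (fun d i => t d i θ) lam z *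
      ∑ d : Fin (D + 1), ∑ i : Idx n d.val,
        t' d i θ * marg n D lam (Nat.lt_succ_iff.mp d.isLt) i *
          (postMean n D π (fun d' i' => t d' i' θ) z d i /
              marg n D lam (Nat.lt_succ_iff.mp d.isLt) i - 1 -
            Real.log (postMean n D π (fun d' i' => t d' i' θ) z d i /
              marg n D lam (Nat.lt_succ_iff.mp d.isLt) i))

namespace PoissonPrediction

open MeasureTheory Filter Topology

lemma poissonPmf_nonneg {x : ℝ} (hx : 0 ≤ x) (k : ℕ) : 0 ≤ poissonPmf x k := by
  unfold poissonPmf; positivity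

lemma poissonPmf_le_pow_div_factorial {x : ℝ} (hx : 0 ≤ x) (k : ℕ) :
    poissonPmf x k ≤ x ^ k / k.factorial := by
  unfold poissonPmf
  gcongr
  exact mul_le_of_le_one_right (by positivity) (Real.exp_le_one_iff.2 (by linarith))

lemma poissonPmf_le_one {x : ℝ} (hx : 0 ≤ x) (k : ℕ) : poissonPmf x k ≤ 1 := by
  have h := Real.pow_div_factorial_le_exp x hx k
  have : poissonPmf x k = x ^ k / k.factorial * Real.exp (-x) := by unfold poissonPmf; ring
  rw [this, Real.exp_neg, ← div_eq_mul_inv]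
  exact (div_le_one (Real.exp_pos x)).2 h

lemma hasSum_poissonPmf (x : ℝ) : HasSum (poissonPmf x) 1 := by
  have h := (NormedSpace.expSeries_div_hasSum_exp x).mul_right (Real.exp (-x))
  rw [← Real.exp_eq_exp_ℝ, ← Real.exp_add, add_neg_cancel, Real.exp_zero] at h
  refine h.congr_fun ?_ |> id
  intro k; unfold poissonPmf; ring

lemma succ_mul_poissonPmf_succ (x : ℝ) (k : ℕ) :
    ((k : ℝ) + 1) * poissonPmf x (k + 1) = x * poissonPmf x k := by
  unfold poissonPmf
  rw [Nat.factorial_succ]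
  have : (k.factorial : ℝ) ≠ 0 := by positivity
  have : (k : ℝ) + 1 ≠ 0 := by positivity
  push_cast
  field_simp
  ring

lemma sum_antidiagonal_poissonPmf (x y : ℝ) (k : ℕ) :
    ∑ p ∈ Finset.HasAntidiagonal.antidiagonal k, poissonPmf x p.1 * poissonPmf y p.2 = poissonPmf (x + y) k := by
  unfold poissonPmf
  rw [(Commute.all x y).add_pow', neg_add, Real.exp_add, Finset.sum_mul, Finset.sum_div]
  refine Finset.sum_congr rfl fun p hp => ?_
  rw [Finset.HasAntidiagonal.mem_antidiagonal] at hp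
  have h := Nat.add_choose_mul_factorial_mul_factorial p.1 p.2
  rw [hp] at h
  rw [← Nat.choose_symm_of_eq_add hp.symm] at h
  have h' : ((k.choose p.1 : ℝ)) * p.1.factorial * p.2.factorial = k.factorial := by
    exact_mod_cast h
  have : (p.1.factorial : ℝ) ≠ 0 := by positivity
  have : (p.2.factorial : ℝ) ≠ 0 := by positivity
  have : (k.factorial : ℝ) ≠ 0 := by positivity
  rw [nsmul_eq_mul, div_mul_div_comm, div_eq_div_iff (by positivity) (by positivity), ← h']
  ring

lemma exp_mul_poissonPmf_le {c m δ : ℝ} (hδ : 0 ≤ δ) (hc : 2 * δ ≤ c) (hm : 0 ≤ m) (k : ℕ) :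
    Real.exp (δ * m) * poissonPmf (c * m) k ≤ 2 ^ k := by
  have h1 : Real.exp (δ * m) * poissonPmf (c * m) k ≤ 2 ^ k * poissonPmf ((c - δ) * m) k := by
    unfold poissonPmf
    have e : Real.exp (-((c - δ) * m)) = Real.exp (δ * m) * Real.exp (-(c * m)) := by
      rw [← Real.exp_add]; ring_nf
    have hp : (c * m) ^ k ≤ 2 ^ k * ((c - δ) * m) ^ k := by
      rw [← mul_pow]
      refine pow_le_pow_left₀ (mul_nonneg (by linarith) hm) ?_ k
      nlinarith
    rw [e, ← mul_div_assoc, ← mul_div_assoc]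
    refine div_le_div_of_nonneg_right ?_ (by positivity)
    calc _ = (c * m) ^ k * (Real.exp (δ * m) * Real.exp (-(c * m))) := by ring
      _ ≤ (2 ^ k * ((c - δ) * m) ^ k) * (Real.exp (δ * m) * Real.exp (-(c * m))) :=
        mul_le_mul_of_nonneg_right hp (by positivity)
      _ = _ := by ring
  refine h1.trans (mul_le_of_le_one_right (by positivity) (poissonPmf_le_one ?_ k))
  exact mul_nonneg (by linarith) hm

lemma summable_pow_div_sqrt_factorial (R : ℝ) :
    Summable fun k : ℕ => R ^ k / √(k.factorial : ℝ) := by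
  refine Summable.of_norm_bounded
    ((Real.summable_pow_div_factorial (4 * R ^ 2)).add
      (summable_geometric_of_lt_one (r := (1 / 4 : ℝ)) (by norm_num) (by norm_num))) fun k => ?_
  have hf : (0 : ℝ) < √(k.factorial : ℝ) := Real.sqrt_pos.2 (by positivity)
  have e1 : (4 * R ^ 2) ^ k / (k.factorial : ℝ) = ((2 * |R|) ^ k / √(k.factorial : ℝ)) ^ 2 := by
    rw [div_pow, Real.sq_sqrt (by positivity), ← pow_mul, mul_comm k 2, pow_mul, mul_pow 2 |R|,
      sq_abs]
    norm_num
  have e2 : (1 / 4 : ℝ) ^ k = ((1 / 2 : ℝ) ^ k) ^ 2 := by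
    rw [← pow_mul, mul_comm k 2, pow_mul]; norm_num
  have e3 : ‖R ^ k / √(k.factorial : ℝ)‖ = ((2 * |R|) ^ k / √(k.factorial : ℝ)) * (1 / 2) ^ k := by
    rw [norm_div, norm_pow, Real.norm_eq_abs, Real.norm_of_nonneg hf.le, div_mul_eq_mul_div,
      ← mul_pow]
    congr 2; ring
  rw [e1, e2, e3]
  nlinarith [sq_nonneg ((2 * |R|) ^ k / √(k.factorial : ℝ) - (1 / 2) ^ k),
    sq_nonneg ((2 * |R|) ^ k / √(k.factorial : ℝ)), sq_nonneg ((1 / 2 : ℝ) ^ k)]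

lemma hasSum_prod_pi {A : Type*} [Fintype A] (f : A → ℕ → ℝ) (s : A → ℝ)
    (hf : ∀ a k, 0 ≤ f a k) (hs : ∀ a, HasSum (f a) (s a)) :
    HasSum (fun z : A → ℕ => ∏ a, f a (z a)) (∏ a, s a) := by
  let P : Type _ → Prop := fun A => ∀ [Fintype A] (f : A → ℕ → ℝ) (s : A → ℝ),
    (∀ a k, 0 ≤ f a k) → (∀ a, HasSum (f a) (s a)) →
      HasSum (fun z : A → ℕ => ∏ a, f a (z a)) (∏ a, s a)
  suffices h : P A from h f s hf hs
  refine Finite.induction_empty_option (P := P) ?_ ?_ ?_ A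
  · intro A B e h _ f s hf hs
    let _ := Fintype.ofEquiv B e.symm
    have := h (fun a => f (e a)) (fun a => s (e a)) (fun a => hf _) (fun a => hs _)
    rw [← Equiv.prod_comp e s, ← (Equiv.arrowCongr e (Equiv.refl ℕ)).hasSum_iff]
    convert this using 2 with z
    rw [Function.comp_apply, ← Equiv.prod_comp e]
    simp [Equiv.arrowCongr]
  · intro _ f s _ _
    simp
  · intro A _ h inst f s hf hs
    obtain rfl : inst = instFintypeOption := Subsingleton.elim _ _
    have h1 := h (fun a => f (some a)) (fun a => s (some a)) (fun a => hf _) (fun a => hs _)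
    have h2 := (hs none).mul h1 ((hs none).summable.mul_of_nonneg h1.summable (hf none)
      fun z => Finset.prod_nonneg fun a _ => hf _ _)
    rw [Fintype.prod_option, ← (Equiv.piOptionEquivProd (β := fun _ => ℕ)).symm.hasSum_iff]
    have e : (fun x : ℕ × (A → ℕ) => f none x.1 * ∏ a, f (some a) (x.2 a)) =
        (fun z : Option A → ℕ => ∏ a, f a (z a)) ∘
          (Equiv.piOptionEquivProd (β := fun _ => ℕ)).symm := by
      funext x
      rw [Function.comp_apply, Fintype.prod_option]
      rfl
    rw [← e]
    exact h2

/-- Joint pmf of independent Poisson variables with means `c a * m a`. -/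
noncomputable def prodPmf {A : Type*} [Fintype A] (c m : A → ℝ) (z : A → ℕ) : ℝ :=
  ∏ a, poissonPmf (c a * m a) (z a)

/-- Likelihood ratio of the Poisson means `c a * m a` against `c a * μ a`. -/
noncomputable def likRatio {A : Type*} [Fintype A] (μ c : A → ℝ) (z : A → ℕ) (m : A → ℝ) : ℝ :=
  (∏ a, (m a / μ a) ^ z a) * Real.exp (-∑ a, c a * (m a - μ a))

section Pmf

variable {A : Type*} [Fintype A] {μ c m : A → ℝ} {z : A → ℕ}

lemma prodPmf_eq_mul_likRatio (hμ : ∀ a, 0 < μ a) (c m : A → ℝ) (z : A → ℕ) :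
    prodPmf c m z = prodPmf c μ z * likRatio μ c z m := by
  unfold prodPmf likRatio
  rw [← Finset.sum_neg_distrib, Real.exp_sum, ← Finset.prod_mul_distrib,
    ← Finset.prod_mul_distrib]
  refine Finset.prod_congr rfl fun a _ => ?_
  unfold poissonPmf
  have h := (hμ a).ne'
  have e : Real.exp (-(c a * m a)) =
      Real.exp (-(c a * μ a)) * Real.exp (-(c a * (m a - μ a))) := by
    rw [← Real.exp_add]; ring_nf
  rw [e, div_pow, mul_pow, mul_pow]
  have : (μ a) ^ z a ≠ 0 := pow_ne_zero _ h
  field_simp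

lemma prodPmf_nonneg (hc : ∀ a, 0 ≤ c a) (hm : ∀ a, 0 ≤ m a) (z : A → ℕ) :
    0 ≤ prodPmf c m z :=
  Finset.prod_nonneg fun a _ => poissonPmf_nonneg (mul_nonneg (hc a) (hm a)) _

lemma prodPmf_le_one (hc : ∀ a, 0 ≤ c a) (hm : ∀ a, 0 ≤ m a) (z : A → ℕ) :
    prodPmf c m z ≤ 1 :=
  Finset.prod_le_one (fun a _ => poissonPmf_nonneg (mul_nonneg (hc a) (hm a)) _)
    fun a _ => poissonPmf_le_one (mul_nonneg (hc a) (hm a)) _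

lemma hasSum_prodPmf (hc : ∀ a, 0 ≤ c a) (hm : ∀ a, 0 ≤ m a) : HasSum (prodPmf c m) 1 := by
  have h := hasSum_prod_pi (fun a => poissonPmf (c a * m a)) (fun _ => 1)
    (fun a k => poissonPmf_nonneg (mul_nonneg (hc a) (hm a)) _) fun a => hasSum_poissonPmf _
  rw [Finset.prod_const_one] at h
  exact h

lemma sqrt_prodPmf_le (hc : ∀ a, 0 ≤ c a) (hm : ∀ a, 0 ≤ m a) {R : ℝ} (hR : 0 ≤ R)
    (h : ∀ a, c a * m a ≤ R ^ 2) (z : A → ℕ) :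
    √(prodPmf c m z) ≤ ∏ a, R ^ z a / √((z a).factorial : ℝ) := by
  unfold prodPmf
  rw [Real.sqrt_prod]
  · refine Finset.prod_le_prod (fun _ _ => Real.sqrt_nonneg _) fun a _ => ?_
    have h0 := mul_nonneg (hc a) (hm a)
    calc √(poissonPmf (c a * m a) (z a)) ≤ √((R ^ z a) ^ 2 / (z a).factorial) := by
          refine Real.sqrt_le_sqrt ((poissonPmf_le_pow_div_factorial h0 _).trans ?_)
          rw [← pow_mul, mul_comm (z a) 2, pow_mul]
          exact div_le_div_of_nonneg_right (pow_le_pow_left₀ h0 (h a) _) (by positivity)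
      _ = _ := by rw [Real.sqrt_div (by positivity), Real.sqrt_sq (by positivity)]
  · exact fun a _ => poissonPmf_nonneg (mul_nonneg (hc a) (hm a)) _

lemma summable_prod_pow_div_sqrt_factorial {R : ℝ} (hR : 0 ≤ R) :
    Summable fun z : A → ℕ => ∏ a, R ^ z a / √((z a).factorial : ℝ) :=
  (hasSum_prod_pi (fun _ k => R ^ k / √((k).factorial : ℝ)) _
    (fun _ _ => by positivity) fun _ => (summable_pow_div_sqrt_factorial R).hasSum).summable

lemma likRatio_nonneg (hμ : ∀ a, 0 < μ a) (hm : ∀ a, 0 ≤ m a) (c : A → ℝ) (z : A → ℕ) :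
    0 ≤ likRatio μ c z m :=
  mul_nonneg (Finset.prod_nonneg fun a _ => pow_nonneg (div_nonneg (hm a) (hμ a).le) _)
    (Real.exp_pos _).le

lemma likRatio_pos (hμ : ∀ a, 0 < μ a) (hm : ∀ a, 0 < m a) (c : A → ℝ) (z : A → ℕ) :
    0 < likRatio μ c z m :=
  mul_pos (Finset.prod_pos fun a _ => pow_pos (div_pos (hm a) (hμ a)) _) (Real.exp_pos _)

lemma likRatio_mul_likRatio (μ c c' : A → ℝ) (z z' : A → ℕ) (m : A → ℝ) :
    likRatio μ c z m * likRatio μ c' z' m =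
      likRatio μ (fun a => c a + c' a) (fun a => z a + z' a) m := by
  unfold likRatio
  simp only [pow_add, Finset.prod_mul_distrib, add_mul, Finset.sum_add_distrib, neg_add,
    Real.exp_add]
  ring

lemma likRatio_add_single [DecidableEq A] (μ c : A → ℝ) (z : A → ℕ) (m : A → ℝ) (a : A) :
    likRatio μ c (z + Pi.single a 1) m = m a / μ a * likRatio μ c z m := by
  unfold likRatio
  simp only [Pi.add_apply, pow_add, Finset.prod_mul_distrib]
  rw [Finset.prod_eq_single (a := a) (f := fun x => (m x / μ x) ^ (Pi.single a 1 : A → ℕ) x)]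
  · simp only [Pi.single_eq_same, pow_one]; ring
  · intro b _ hb; simp [Pi.single_eq_of_ne hb]
  · simp

lemma mul_prodPmf_add_single [DecidableEq A] (c m : A → ℝ) (z : A → ℕ) (a : A) :
    ((z a : ℝ) + 1) * prodPmf c m (z + Pi.single a 1) = c a * m a * prodPmf c m z := by
  unfold prodPmf
  rw [← Finset.mul_prod_erase _ _ (Finset.mem_univ a), ← mul_assoc,
    ← Finset.mul_prod_erase Finset.univ (fun b => poissonPmf (c b * m b) (z b))
      (Finset.mem_univ a), ← mul_assoc]
  congr 1
  · simpa using succ_mul_poissonPmf_succ (c a * m a) (z a)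
  · refine Finset.prod_congr rfl fun b hb => ?_
    simp [Pi.single_eq_of_ne (Finset.ne_of_mem_erase hb)]

lemma prodPmf_pos_of (hm : ∀ a, 0 < m a) (h : ∀ a, z a ≠ 0 → 0 < c a) :
    0 < prodPmf c m z := by
  refine Finset.prod_pos fun a _ => ?_
  unfold poissonPmf
  have : 0 < (c a * m a) ^ z a := by
    by_cases hz : z a = 0
    · simp [hz]
    · exact pow_pos (mul_pos (h a hz) (hm a)) _
  positivity

lemma prodPmf_eq_zero {a : A} (hz : z a ≠ 0) (hc : c a = 0) : prodPmf c m z = 0 := by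
  refine Finset.prod_eq_zero (Finset.mem_univ a) ?_
  simp [poissonPmf, hc, hz]

lemma exp_mul_prodPmf_le (hc : ∀ a, 0 ≤ c a) (hm : ∀ a, 0 ≤ m a) {δ : ℝ} (hδ : 0 ≤ δ) {a : A}
    (ha : 2 * δ ≤ c a) (z : A → ℕ) : Real.exp (δ * m a) * prodPmf c m z ≤ 2 ^ z a := by
  classical
  unfold prodPmf
  rw [← Finset.mul_prod_erase _ _ (Finset.mem_univ a), ← mul_assoc]
  refine (mul_le_of_le_one_right ?_ ?_).trans (exp_mul_poissonPmf_le hδ ha (hm a) (z a))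
  · exact mul_nonneg (Real.exp_pos _).le (poissonPmf_nonneg (mul_nonneg (hc a) (hm a)) _)
  · exact Finset.prod_le_one (fun a _ => poissonPmf_nonneg (mul_nonneg (hc a) (hm a)) _)
      fun a _ => poissonPmf_le_one (mul_nonneg (hc a) (hm a)) _

lemma hasDerivAt_prodPmf (μ : A → ℝ) (z : A → ℕ) {t t' : A → ℝ → ℝ} {θ : ℝ}
    (ht : ∀ a, HasDerivAt (t a) (t' a θ) θ) (h0 : ∀ a, z a ≠ 0 → t a θ ≠ 0) :
    HasDerivAt (fun x => prodPmf (fun a => t a x) μ z)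
      (prodPmf (fun a => t a θ) μ z * ∑ a, t' a θ * (z a / t a θ - μ a)) θ := by
  classical
  have h1 : ∀ a ∈ (Finset.univ : Finset A), HasDerivAt (fun x => poissonPmf (t a x * μ a) (z a))
      (poissonPmf (t a θ * μ a) (z a) * (t' a θ * (z a / t a θ - μ a))) θ := by
    intro a _
    unfold poissonPmf
    have h := ((((ht a).mul_const (μ a)).pow (z a)).mul
      ((ht a).mul_const (μ a)).neg.exp).div_const ((z a).factorial : ℝ)
    refine h.congr_deriv ?_
    rcases Nat.eq_zero_or_pos (z a) with hz | hz
    · simp [hz]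
    · obtain ⟨k, hk⟩ : ∃ k, z a = k + 1 := ⟨z a - 1, by omega⟩
      have := h0 a hz.ne'
      simp only [hk, Pi.pow_apply, Pi.neg_apply, Nat.add_sub_cancel]
      field_simp
      ring
  refine (HasDerivAt.fun_finsetProd h1).congr_deriv ?_
  unfold prodPmf
  rw [Finset.mul_sum]
  refine Finset.sum_congr rfl fun a ha => ?_
  rw [← Finset.mul_prod_erase _ _ ha, smul_eq_mul]
  ring

lemma tsum_prodPmf_mul_prodPmf (c c' m : A → ℝ) (f : (A → ℕ) → ℝ)
    (hf : Summable fun p : (A → ℕ) × (A → ℕ) =>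
      prodPmf c m p.1 * prodPmf c' m p.2 * f (fun a => p.1 a + p.2 a)) :
    ∑' p : (A → ℕ) × (A → ℕ), prodPmf c m p.1 * prodPmf c' m p.2 * f (fun a => p.1 a + p.2 a) =
      ∑' z, prodPmf (fun a => c a + c' a) m z * f z := by
  classical
  let e := (Equiv.arrowProdEquivProdArrow A (fun _ => ℕ) (fun _ => ℕ))
  rw [← e.tsum_eq]
  rw [← e.summable_iff] at hf
  refine (hf.hasSum.tsum_fiberwise fun q a => (q a).1 + (q a).2).tsum_eq.symm.trans ?_
  refine tsum_congr fun z => ?_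
  let S := Fintype.piFinset fun a => Finset.HasAntidiagonal.antidiagonal (z a)
  have hS : (fun (q : A → ℕ × ℕ) a => (q a).1 + (q a).2) ⁻¹' {z} = (S : Set (A → ℕ × ℕ)) := by
    ext q
    simp [S, funext_iff]
  rw [hS]
  have := Finset.tsum_subtype S
    ((fun p => prodPmf c m p.1 * prodPmf c' m p.2 * f fun a => p.1 a + p.2 a) ∘ e)
  refine this.trans ?_
  unfold prodPmf
  simp only [add_mul]
  rw [Finset.prod_congr rfl fun a _ => (sum_antidiagonal_poissonPmf (c a * m a) (c' a * m a)
    (z a)).symm, Finset.prod_univ_sum, Finset.sum_mul]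
  refine Finset.sum_congr rfl fun q hq => ?_
  have : (fun a => (q a).1 + (q a).2) = z := by
    rw [← Set.mem_singleton_iff, ← Set.mem_preimage (f := fun (q : A → ℕ × ℕ) a =>
      (q a).1 + (q a).2), hS]
    exact hq
  rw [Finset.prod_mul_distrib, ← this]
  rfl

end Pmf

/-- A prior `π`, carrying random integrable positive means `M`, and a positive true mean `μ`. -/
structure IsPositiveModel {A Ω : Type*} [MeasurableSpace Ω] (π : Measure Ω) (M : Ω → A → ℝ)
    (μ : A → ℝ) : Prop where
  measurable : ∀ a, Measurable fun ω => M ω a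
  pos : ∀ᵐ ω ∂π, ∀ a, 0 < M ω a
  integrable : ∀ a, Integrable (fun ω => M ω a) π
  base_pos : ∀ a, 0 < μ a

/-- Evidence of the data `z`, relative to the true mean `μ`. -/
noncomputable def evidence {A Ω : Type*} [Fintype A] [MeasurableSpace Ω] (π : Measure Ω)
    (M : Ω → A → ℝ) (μ c : A → ℝ) (z : A → ℕ) : ℝ :=
  ∫ ω, likRatio μ c z (M ω) ∂π

/-- Posterior mean of `M · a`, computed from likelihood ratios. -/
noncomputable def posteriorAvg {A Ω : Type*} [Fintype A] [MeasurableSpace Ω] (π : Measure Ω)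
    (M : Ω → A → ℝ) (μ c : A → ℝ) (z : A → ℕ) (a : A) : ℝ :=
  (∫ ω, M ω a * likRatio μ c z (M ω) ∂π) / evidence π M μ c z

section Evidence

variable {A Ω : Type*} [Fintype A] [MeasurableSpace Ω] {π : Measure Ω} [IsProbabilityMeasure π]
  {M : Ω → A → ℝ} {μ c : A → ℝ} {z : A → ℕ}

omit [IsProbabilityMeasure π] in
lemma IsPositiveModel.measurable_likRatio (h : IsPositiveModel π M μ) (c : A → ℝ) (z : A → ℕ) :
    Measurable fun ω => likRatio μ c z (M ω) := by
  unfold likRatio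
  have := h.measurable
  fun_prop

omit [IsProbabilityMeasure π] in
lemma IsPositiveModel.likRatio_le (h : IsPositiveModel π M μ) (hc : ∀ a, 0 ≤ c a)
    (hP : 0 < prodPmf c μ z) : ∀ᵐ ω ∂π, likRatio μ c z (M ω) ≤ 1 / prodPmf c μ z := by
  filter_upwards [h.pos] with ω hω
  rw [le_div_iff₀ hP, mul_comm, ← prodPmf_eq_mul_likRatio h.base_pos]
  exact prodPmf_le_one hc (fun a => (hω a).le) z

omit [IsProbabilityMeasure π] in
lemma IsPositiveModel.norm_likRatio_le (h : IsPositiveModel π M μ) (hc : ∀ a, 0 ≤ c a)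
    (hP : 0 < prodPmf c μ z) : ∀ᵐ ω ∂π, ‖likRatio μ c z (M ω)‖ ≤ 1 / prodPmf c μ z := by
  filter_upwards [h.pos, h.likRatio_le hc hP] with ω hω h1
  rwa [Real.norm_of_nonneg (likRatio_nonneg h.base_pos (fun a => (hω a).le) c z)]

lemma IsPositiveModel.integrable_likRatio (h : IsPositiveModel π M μ) (hc : ∀ a, 0 ≤ c a)
    (hP : 0 < prodPmf c μ z) : Integrable (fun ω => likRatio μ c z (M ω)) π :=
  Integrable.of_bound (h.measurable_likRatio c z).aestronglyMeasurable _
    (h.norm_likRatio_le hc hP)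

omit [IsProbabilityMeasure π] in
lemma IsPositiveModel.integrable_mul_likRatio (h : IsPositiveModel π M μ) (hc : ∀ a, 0 ≤ c a)
    (hP : 0 < prodPmf c μ z) (a : A) :
    Integrable (fun ω => M ω a * likRatio μ c z (M ω)) π := by
  have := (h.integrable a).bdd_mul (h.measurable_likRatio c z).aestronglyMeasurable
    (h.norm_likRatio_le hc hP)
  simpa only [mul_comm] using this

lemma integral_pos_of_ae_pos {f : Ω → ℝ} (hf : Integrable f π) (h : ∀ᵐ ω ∂π, 0 < f ω) :
    0 < ∫ ω, f ω ∂π := by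
  rw [integral_pos_iff_support_of_nonneg_ae (h.mono fun _ => le_of_lt) hf]
  have : Function.support f =ᵐ[π] (Set.univ : Set Ω) :=
    eventuallyEq_univ.2 (h.mono fun _ h => h.ne')
  rw [measure_congr this, measure_univ]
  exact one_pos

lemma IsPositiveModel.evidence_pos (h : IsPositiveModel π M μ) (hc : ∀ a, 0 ≤ c a)
    (hP : 0 < prodPmf c μ z) : 0 < evidence π M μ c z :=
  integral_pos_of_ae_pos (h.integrable_likRatio hc hP) <| h.pos.mono fun _ hω =>
    likRatio_pos h.base_pos hω c z

lemma IsPositiveModel.prodPmf_mul_evidence_le_one (h : IsPositiveModel π M μ)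
    (hc : ∀ a, 0 ≤ c a) (hP : 0 < prodPmf c μ z) :
    prodPmf c μ z * evidence π M μ c z ≤ 1 := by
  have : evidence π M μ c z ≤ ∫ _, 1 / prodPmf c μ z ∂π :=
    integral_mono_ae (h.integrable_likRatio hc hP) (integrable_const _) (h.likRatio_le hc hP)
  rw [integral_const, probReal_univ, one_smul] at this
  calc _ ≤ prodPmf c μ z * (1 / prodPmf c μ z) := mul_le_mul_of_nonneg_left this hP.le
    _ = 1 := by field_simp

lemma IsPositiveModel.exists_box (h : IsPositiveModel π M μ) :
    ∃ k : ℕ, 0 < π {ω | ∀ a, Real.exp (-k) ≤ M ω a / μ a ∧ M ω a ≤ k} := by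
  by_contra! hk
  have h0 : π (⋃ k : ℕ, {ω | ∀ a, Real.exp (-k) ≤ M ω a / μ a ∧ M ω a ≤ k}) = 0 :=
    measure_iUnion_null fun k => le_antisymm (hk k) bot_le
  have h1 : ∀ᵐ ω ∂π, ω ∈ (⋃ k : ℕ, {ω | ∀ a, Real.exp (-k) ≤ M ω a / μ a ∧ M ω a ≤ k}) := by
    filter_upwards [h.pos] with ω hω
    have ht : Tendsto (fun k : ℕ => Real.exp (-(k : ℝ))) atTop (𝓝 0) :=
      Real.tendsto_exp_neg_atTop_nhds_zero.comp tendsto_natCast_atTop_atTop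
    have : ∀ᶠ k : ℕ in atTop, ∀ a, Real.exp (-k) ≤ M ω a / μ a ∧ M ω a ≤ k :=
      eventually_all.2 fun a => (ht.eventually_le_const (div_pos (hω a) (h.base_pos a))).and
        (tendsto_natCast_atTop_atTop.eventually_ge_atTop (M ω a))
    obtain ⟨k, hk⟩ := this.exists
    exact Set.mem_iUnion.2 ⟨k, hk⟩
  exact one_ne_zero (measure_univ.symm.trans ((measure_congr (eventuallyEq_univ.2 h1)).symm.trans h0))

lemma IsPositiveModel.exists_exp_le_evidence (h : IsPositiveModel π M μ) (T : ℝ) :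
    ∃ C : ℝ, 0 ≤ C ∧ ∀ (c : A → ℝ) (z : A → ℕ), (∀ a, 0 ≤ c a) → (∀ a, c a ≤ T) →
      0 < prodPmf c μ z → Real.exp (-(C * (1 + ∑ a, (z a : ℝ)))) ≤ evidence π M μ c z := by
  obtain ⟨k, hk⟩ := h.exists_box
  set B := {ω | ∀ a, Real.exp (-k) ≤ M ω a / μ a ∧ M ω a ≤ k} with hB
  have hBm : MeasurableSet B := by
    rw [hB, Set.ofPred_forall]
    exact MeasurableSet.iInter fun a =>
      (measurableSet_le measurable_const ((h.measurable a).div_const _)).inter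
        (measurableSet_le (h.measurable a) measurable_const)
  have hπ : 0 < π.real B := ENNReal.toReal_pos hk.ne' (measure_ne_top _ _)
  set C := |Real.log (π.real B)| + Fintype.card A * (|T| * k) + k with hC
  refine ⟨C, by positivity, fun c z hc hcT hP => ?_⟩
  have hint := h.integrable_likRatio hc hP
  have hlow : ∀ ω ∈ B,
      Real.exp (-(k * ∑ a, (z a : ℝ)) - Fintype.card A * (|T| * k)) ≤ likRatio μ c z (M ω) := by
    intro ω hω
    unfold likRatio
    rw [sub_eq_add_neg, Real.exp_add]
    refine mul_le_mul ?_ ?_ (Real.exp_pos _).le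
      (Finset.prod_nonneg fun a _ => pow_nonneg ((Real.exp_pos _).le.trans (hω a).1) _)
    · rw [Finset.mul_sum, ← Finset.sum_neg_distrib, Real.exp_sum]
      refine Finset.prod_le_prod (fun _ _ => (Real.exp_pos _).le) fun a _ => ?_
      rw [← neg_mul, mul_comm, Real.exp_nat_mul]
      exact pow_le_pow_left₀ (Real.exp_pos _).le (hω a).1 _
    · refine Real.exp_le_exp.2 (neg_le_neg ?_)
      rw [← nsmul_eq_mul, ← Finset.card_univ, ← Finset.sum_const]
      refine Finset.sum_le_sum fun a _ => ?_
      have := (hω a).2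
      have := h.base_pos a
      calc c a * (M ω a - μ a) ≤ c a * k := mul_le_mul_of_nonneg_left (by linarith) (hc a)
        _ ≤ |T| * k := mul_le_mul_of_nonneg_right ((hcT a).trans (le_abs_self T)) (by positivity)
  have hnn : 0 ≤ᵐ[π] fun ω => likRatio μ c z (M ω) := h.pos.mono fun ω hω =>
    likRatio_nonneg h.base_pos (fun a => (hω a).le) c z
  calc Real.exp (-(C * (1 + ∑ a, (z a : ℝ))))
      ≤ π.real B * Real.exp (-(k * ∑ a, (z a : ℝ)) - Fintype.card A * (|T| * k)) := by
        conv_rhs => rw [← Real.exp_log hπ, ← Real.exp_add]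
        refine Real.exp_le_exp.2 ?_
        have h1 := neg_abs_le (Real.log (π.real B))
        have h2 : (0 : ℝ) ≤ ∑ a, (z a : ℝ) := by positivity
        have h0 : 0 ≤ |Real.log (π.real B)| + Fintype.card A * (|T| * k) := by positivity
        have h3 : (k : ℝ) ≤ C := by linarith
        have h4 := mul_le_mul_of_nonneg_right h3 h2
        have h5 : (0 : ℝ) ≤ k := by positivity
        linarith
    _ = ∫ _ in B, Real.exp (-(k * ∑ a, (z a : ℝ)) - Fintype.card A * (|T| * k)) ∂π := by
        rw [setIntegral_const, smul_eq_mul]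
    _ ≤ ∫ ω in B, likRatio μ c z (M ω) ∂π :=
        setIntegral_mono_on (integrable_const _).integrableOn hint.integrableOn hBm hlow
    _ ≤ evidence π M μ c z := setIntegral_le_integral hint hnn

lemma log_le_two_mul_sqrt {x : ℝ} (hx : 0 < x) : Real.log x ≤ 2 * √x := by
  have h1 : Real.log x = 2 * Real.log (√x) := by
    rw [Real.log_sqrt hx.le]; ring
  have h2 := Real.log_le_sub_one_of_pos (Real.sqrt_pos.2 hx)
  linarith

lemma mul_sqrt_le_sqrt_mul {p x b : ℝ} (hp : 0 ≤ p) (h : p * x ≤ b) :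
    p * √x ≤ √p * √b := by
  calc p * √x = √p * √(p * x) := by
        rw [Real.sqrt_mul hp, ← mul_assoc, Real.mul_self_sqrt hp]
    _ ≤ _ := mul_le_mul_of_nonneg_left (Real.sqrt_le_sqrt h) (Real.sqrt_nonneg _)

lemma IsPositiveModel.prodPmf_mul_abs_log_evidence_le (h : IsPositiveModel π M μ)
    (hc : ∀ a, 0 ≤ c a) {K : ℝ} (hK : 0 ≤ K)
    (hlow : 0 < prodPmf c μ z → Real.exp (-K) ≤ evidence π M μ c z) :
    prodPmf c μ z * |Real.log (evidence π M μ c z)| ≤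
      K * prodPmf c μ z + 2 * √(prodPmf c μ z) := by
  rcases (prodPmf_nonneg hc (fun a => (h.base_pos a).le) z).eq_or_lt with h0 | hP
  · rw [← h0]; simp
  have hG := h.evidence_pos hc hP
  have h1 : -K ≤ Real.log (evidence π M μ c z) := (Real.le_log_iff_exp_le hG).2 (hlow hP)
  have h2 := log_le_two_mul_sqrt hG
  have h3 := mul_sqrt_le_sqrt_mul hP.le (h.prodPmf_mul_evidence_le_one hc hP)
  rw [Real.sqrt_one, mul_one] at h3
  have h4 : |Real.log (evidence π M μ c z)| ≤ K + 2 * √(evidence π M μ c z) := by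
    have := Real.sqrt_nonneg (evidence π M μ c z)
    rw [abs_le]; constructor <;> linarith
  calc _ ≤ prodPmf c μ z * (K + 2 * √(evidence π M μ c z)) :=
        mul_le_mul_of_nonneg_left h4 hP.le
    _ ≤ _ := by linarith

lemma IsPositiveModel.posteriorAvg_nonneg (h : IsPositiveModel π M μ) (hc : ∀ a, 0 ≤ c a)
    (hP : 0 < prodPmf c μ z) (a : A) : 0 ≤ posteriorAvg π M μ c z a :=
  div_nonneg (integral_nonneg_of_ae (h.pos.mono fun _ hω => mul_nonneg (hω a).le
    (likRatio_nonneg h.base_pos (fun a => (hω a).le) c z))) (h.evidence_pos hc hP).le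

lemma IsPositiveModel.prodPmf_mul_posteriorAvg_le (h : IsPositiveModel π M μ)
    (hc : ∀ a, 0 ≤ c a) (hP : 0 < prodPmf c μ z) {K : ℝ}
    (hlow : Real.exp (-K) ≤ evidence π M μ c z) {δ : ℝ} (hδ : 0 < δ) {a : A}
    (ha : 2 * δ ≤ c a) :
    δ * (prodPmf c μ z * posteriorAvg π M μ c z a) ≤
      2 * (√(prodPmf c μ z) * 2 ^ z a) + K * prodPmf c μ z := by
  have hG := h.evidence_pos hc hP
  set P := prodPmf c μ z with hPdef
  set G := evidence π M μ c z with hGdef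
  have hexp : ∀ᵐ ω ∂π, Real.exp (δ * M ω a) * likRatio μ c z (M ω) ≤ 2 ^ z a / P := by
    filter_upwards [h.pos] with ω hω
    have := exp_mul_prodPmf_le hc (fun a => (hω a).le) hδ.le ha z
    rw [prodPmf_eq_mul_likRatio h.base_pos] at this
    rw [le_div_iff₀ hP]
    linarith
  have hepos : ∀ᵐ ω ∂π, 0 < Real.exp (δ * M ω a) * likRatio μ c z (M ω) :=
    h.pos.mono fun ω hω => mul_pos (Real.exp_pos _) (likRatio_pos h.base_pos hω c z)
  have heint : Integrable (fun ω => Real.exp (δ * M ω a) * likRatio μ c z (M ω)) π := by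
    refine Integrable.of_bound (C := 2 ^ z a / P) ?_ ?_
    · exact (((h.measurable a).const_mul δ).exp.mul
        (h.measurable_likRatio c z)).aestronglyMeasurable
    · filter_upwards [hexp, hepos] with ω h1 h2
      rwa [Real.norm_of_nonneg h2.le]
  set E := ∫ ω, Real.exp (δ * M ω a) * likRatio μ c z (M ω) ∂π with hE
  have hEpos : 0 < E := integral_pos_of_ae_pos heint hepos
  have hPE : P * E ≤ 2 ^ z a := by
    have : E ≤ ∫ _, 2 ^ z a / P ∂π := integral_mono_ae heint (integrable_const _) hexp
    rw [integral_const, probReal_univ, one_smul, le_div_iff₀ hP] at this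
    linarith
  have hjensen : δ * posteriorAvg π M μ c z a ≤ Real.log (E / G) := by
    have hEG := div_pos hEpos hG
    have hpt : ∀ᵐ ω ∂π, δ * (M ω a * likRatio μ c z (M ω)) ≤
        (Real.log (E / G) - 1) * likRatio μ c z (M ω) +
          (E / G)⁻¹ * (Real.exp (δ * M ω a) * likRatio μ c z (M ω)) := by
      filter_upwards [h.pos] with ω hω
      have h1 := likRatio_nonneg h.base_pos (fun a => (hω a).le) c z
      have h2 := Real.log_le_sub_one_of_pos (div_pos (Real.exp_pos (δ * M ω a)) hEG)
      rw [Real.log_div (Real.exp_pos _).ne' hEG.ne', Real.log_exp] at h2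
      have h3 : δ * M ω a ≤ (Real.log (E / G) - 1) + (E / G)⁻¹ * Real.exp (δ * M ω a) := by
        rw [div_eq_mul_inv _ (E / G)] at h2
        linarith
      calc _ = (δ * M ω a) * likRatio μ c z (M ω) := by ring
        _ ≤ _ := mul_le_mul_of_nonneg_right h3 h1
        _ = _ := by ring
    have hI := integral_mono_ae ((h.integrable_mul_likRatio hc hP a).const_mul δ)
      (((h.integrable_likRatio hc hP).const_mul _).add (heint.const_mul _)) hpt
    rw [integral_const_mul] at hI
    simp only [Pi.add_apply] at hI
    rw [integral_add ((h.integrable_likRatio hc hP).const_mul _) (heint.const_mul _),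
      integral_const_mul, integral_const_mul, ← hE] at hI
    change _ ≤ _ * G + _ at hI
    have hEG' : (E / G)⁻¹ * E = G := by field_simp
    unfold posteriorAvg
    rw [← hGdef, ← mul_div_assoc, div_le_iff₀ hG]
    linarith
  rw [Real.log_div hEpos.ne' hG.ne'] at hjensen
  have h1 : -K ≤ Real.log G := (Real.le_log_iff_exp_le hG).2 hlow
  have h2 := log_le_two_mul_sqrt hEpos
  have h3 := mul_sqrt_le_sqrt_mul hP.le hPE
  have h4 : √((2 : ℝ) ^ z a) ≤ 2 ^ z a := by
    rw [Real.sqrt_le_left (by positivity)]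
    nlinarith [one_le_pow₀ (n := z a) (one_le_two (α := ℝ))]
  have h5 := mul_le_mul_of_nonneg_left h4 (Real.sqrt_nonneg P)
  calc _ = P * (δ * posteriorAvg π M μ c z a) := by ring
    _ ≤ P * (2 * √E + K) := mul_le_mul_of_nonneg_left (by linarith) hP.le
    _ ≤ _ := by linarith

end Evidence

/-- A nonnegative monotone `C¹` interpolation on `[0, 1]`. -/
structure IsInterpolation {A : Type*} (t t' : A → ℝ → ℝ) : Prop where
  zero_nonneg : ∀ a, 0 ≤ t a 0
  mono : ∀ a, MonotoneOn (t a) (Set.Icc 0 1)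
  hasDerivAt : ∀ a, ∀ θ ∈ Set.Icc (0 : ℝ) 1, HasDerivAt (t a) (t' a θ) θ
  continuousOn_deriv : ∀ a, ContinuousOn (t' a) (Set.Icc 0 1)

section Interpolation

variable {A Ω : Type*} [Fintype A] [MeasurableSpace Ω] {π : Measure Ω} [IsProbabilityMeasure π]
  {M : Ω → A → ℝ} {μ : A → ℝ} {z : A → ℕ} {t t' : A → ℝ → ℝ}

omit [Fintype A] in
lemma IsInterpolation.nonneg (ht : IsInterpolation t t') (a : A) {θ : ℝ}
    (hθ : θ ∈ Set.Icc (0 : ℝ) 1) : 0 ≤ t a θ :=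
  (ht.zero_nonneg a).trans (ht.mono a ⟨le_rfl, zero_le_one⟩ hθ hθ.1)

omit [Fintype A] in
lemma IsInterpolation.continuousOn (ht : IsInterpolation t t') :
    ContinuousOn (fun θ a => t a θ) (Set.Icc 0 1) :=
  continuousOn_pi.2 fun a θ hθ => (ht.hasDerivAt a θ hθ).continuousAt.continuousWithinAt

lemma IsInterpolation.exists_le (ht : IsInterpolation t t') :
    ∃ T : ℝ, 0 ≤ T ∧ ∀ a, ∀ θ ∈ Set.Icc (0 : ℝ) 1, t a θ ≤ T := by
  have h1 : ∀ a, 0 ≤ t a 1 := fun a => ht.nonneg a ⟨zero_le_one, le_rfl⟩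
  refine ⟨∑ a, t a 1, Finset.sum_nonneg fun a _ => h1 a, fun a θ hθ => ?_⟩
  exact (ht.mono a hθ ⟨zero_le_one, le_rfl⟩ hθ.2).trans
    (Finset.single_le_sum (f := fun a => t a 1) (fun a _ => h1 a) (Finset.mem_univ a))

lemma IsInterpolation.exists_abs_deriv_le (ht : IsInterpolation t t') :
    ∃ B : ℝ, 0 ≤ B ∧ ∀ a, ∀ θ ∈ Set.Icc (0 : ℝ) 1, |t' a θ| ≤ B := by
  choose B hB using fun a => isCompact_Icc.exists_bound_of_continuousOn (ht.continuousOn_deriv a)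
  refine ⟨∑ a, |B a|, Finset.sum_nonneg fun a _ => abs_nonneg _, fun a θ hθ => ?_⟩
  exact ((hB a θ hθ).trans (le_abs_self _)).trans
    (Finset.single_le_sum (f := fun a => |B a|) (fun a _ => abs_nonneg _) (Finset.mem_univ a))

lemma continuous_prodPmf (μ : A → ℝ) (z : A → ℕ) : Continuous fun c => prodPmf c μ z := by
  unfold prodPmf poissonPmf; fun_prop

lemma continuous_likRatio (μ : A → ℝ) (z : A → ℕ) (m : A → ℝ) :
    Continuous fun c => likRatio μ c z m := by
  unfold likRatio; fun_prop

lemma IsPositiveModel.continuousOn_prodPmf_mul_log_evidence (h : IsPositiveModel π M μ)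
    (ht : IsInterpolation t t') (z : A → ℕ) :
    ContinuousOn (fun θ => prodPmf (fun a => t a θ) μ z *
      Real.log (evidence π M μ (fun a => t a θ) z)) (Set.Icc 0 1) := by
  intro θ hθ
  have hcP : ContinuousWithinAt (fun θ => prodPmf (fun a => t a θ) μ z) (Set.Icc 0 1) θ :=
    ((continuous_prodPmf μ z).comp_continuousOn ht.continuousOn) θ hθ
  obtain ⟨T, -, hT⟩ := ht.exists_le
  obtain ⟨C, hC, hlow⟩ := h.exists_exp_le_evidence T
  rcases (prodPmf_nonneg (fun a => ht.nonneg a hθ) (fun a => (h.base_pos a).le) z).eq_or_lt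
    with h0 | hP
  · unfold ContinuousWithinAt at hcP ⊢
    beta_reduce at hcP ⊢
    rw [← h0] at hcP ⊢
    rw [zero_mul]
    have hlim : Tendsto (fun θ => (C * (1 + ∑ a, (z a : ℝ))) * prodPmf (fun a => t a θ) μ z +
        2 * √(prodPmf (fun a => t a θ) μ z)) (𝓝[Set.Icc 0 1] θ) (𝓝 0) := by
      simpa using (hcP.const_mul (C * (1 + ∑ a, (z a : ℝ)))).add (hcP.sqrt.const_mul 2)
    refine squeeze_zero_norm' ?_ hlim
    filter_upwards [self_mem_nhdsWithin] with x hx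
    rw [norm_mul, Real.norm_eq_abs, Real.norm_eq_abs,
      abs_of_nonneg (prodPmf_nonneg (fun a => ht.nonneg a hx) (fun a => (h.base_pos a).le) z)]
    exact h.prodPmf_mul_abs_log_evidence_le (fun a => ht.nonneg a hx) (by positivity)
      fun hP => hlow _ z (fun a => ht.nonneg a hx) (fun a => hT a x hx) hP
  · refine hcP.mul (ContinuousWithinAt.log ?_ (h.evidence_pos (fun a => ht.nonneg a hθ) hP).ne')
    refine continuousWithinAt_of_dominated
      (bound := fun _ => 1 / (prodPmf (fun a => t a θ) μ z / 2)) ?_ ?_ (integrable_const _) ?_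
    · exact Eventually.of_forall fun x => (h.measurable_likRatio _ z).aestronglyMeasurable
    · filter_upwards [self_mem_nhdsWithin, hcP.eventually_const_lt (half_lt_self hP)] with x hx hxP
      filter_upwards [h.norm_likRatio_le (fun a => ht.nonneg a hx) ((half_pos hP).trans hxP)]
        with ω hω
      exact hω.trans (one_div_le_one_div_of_le (half_pos hP) hxP.le)
    · exact Eventually.of_forall fun ω =>
        ((continuous_likRatio μ z (M ω)).comp_continuousOn ht.continuousOn) θ hθ

lemma hasDerivAt_likRatio (μ : A → ℝ) (z : A → ℕ) (m : A → ℝ) {θ : ℝ}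
    (ht : ∀ a, HasDerivAt (t a) (t' a θ) θ) :
    HasDerivAt (fun x => likRatio μ (fun a => t a x) z m)
      (likRatio μ (fun a => t a θ) z m * -∑ a, t' a θ * (m a - μ a)) θ := by
  unfold likRatio
  have h := (HasDerivAt.fun_sum (u := Finset.univ) fun a _ =>
    (ht a).mul_const (m a - μ a)).fun_neg.exp.const_mul (∏ a, (m a / μ a) ^ z a)
  exact h.congr_deriv (by ring)

lemma IsPositiveModel.hasDerivAt_evidence (h : IsPositiveModel π M μ)
    (ht : IsInterpolation t t') {θ : ℝ} (hθ : θ ∈ Set.Ioo (0 : ℝ) 1)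
    (hP : 0 < prodPmf (fun a => t a θ) μ z) :
    HasDerivAt (fun x => evidence π M μ (fun a => t a x) z)
      (-(evidence π M μ (fun a => t a θ) z *
        ∑ a, t' a θ * (posteriorAvg π M μ (fun a => t a θ) z a - μ a))) θ := by
  obtain ⟨B, hB, hB'⟩ := ht.exists_abs_deriv_le
  have hθ' := Set.Ioo_subset_Icc_self hθ
  have hc : ∀ a, 0 ≤ t a θ := fun a => ht.nonneg a hθ'
  set b := prodPmf (fun a => t a θ) μ z / 2 with hb
  have hbpos : 0 < b := half_pos hP
  have hcP : ContinuousAt (fun θ => prodPmf (fun a => t a θ) μ z) θ :=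
    ((continuous_prodPmf μ z).comp_continuousOn ht.continuousOn).continuousAt
      (Icc_mem_nhds hθ.1 hθ.2)
  have hs : {x | x ∈ Set.Icc (0 : ℝ) 1 ∧ b < prodPmf (fun a => t a x) μ z} ∈ 𝓝 θ :=
    Filter.inter_mem (Icc_mem_nhds hθ.1 hθ.2) (hcP.eventually_const_lt (half_lt_self hP))
  have key := (hasDerivAt_integral_of_dominated_loc_of_deriv_le (μ := π) (𝕜 := ℝ)
    (F := fun x ω => likRatio μ (fun a => t a x) z (M ω))
    (F' := fun x ω => likRatio μ (fun a => t a x) z (M ω) * -∑ a, t' a x * (M ω a - μ a))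
    (bound := fun ω => 1 / b * ∑ a, B * (M ω a + μ a)) hs
    (Eventually.of_forall fun x => (h.measurable_likRatio _ z).aestronglyMeasurable)
    (h.integrable_likRatio hc hP) ?_ ?_ ?_ ?_).2
  · refine key.congr_deriv ?_
    have hG := (h.evidence_pos hc hP).ne'
    have e : ∀ ω, likRatio μ (fun a => t a θ) z (M ω) * -∑ a, t' a θ * (M ω a - μ a) =
        ∑ a, (-t' a θ) * (M ω a * likRatio μ (fun a => t a θ) z (M ω) -
          μ a * likRatio μ (fun a => t a θ) z (M ω)) := by
      intro ω
      rw [← Finset.sum_neg_distrib, Finset.mul_sum]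
      exact Finset.sum_congr rfl fun a _ => by ring
    have hi : ∀ a, Integrable (fun ω => M ω a * likRatio μ (fun a => t a θ) z (M ω) -
        μ a * likRatio μ (fun a => t a θ) z (M ω)) π := fun a => (h.integrable_mul_likRatio hc hP a).sub
      ((h.integrable_likRatio hc hP).const_mul (μ a))
    simp only [e]
    rw [integral_finsetSum _ fun a _ => (hi a).const_mul _, Finset.mul_sum,
      ← Finset.sum_neg_distrib]
    refine Finset.sum_congr rfl fun a _ => ?_
    rw [integral_const_mul, integral_sub (h.integrable_mul_likRatio hc hP a)
      ((h.integrable_likRatio hc hP).const_mul (μ a)), integral_const_mul]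
    unfold posteriorAvg
    unfold evidence at hG ⊢
    field_simp
  · have := h.measurable
    have := h.measurable_likRatio (fun a => t a θ) z
    exact Measurable.aestronglyMeasurable (by fun_prop)
  · filter_upwards [h.pos] with ω hω x hx
    have hm : ∀ a, 0 ≤ M ω a := fun a => (hω a).le
    have hx0 : ∀ a, 0 ≤ t a x := fun a => ht.nonneg a hx.1
    have h1 : likRatio μ (fun a => t a x) z (M ω) ≤ 1 / b := by
      have h2 := prodPmf_le_one hx0 hm z
      have h3 := likRatio_nonneg h.base_pos hm (fun a => t a x) z
      rw [prodPmf_eq_mul_likRatio h.base_pos] at h2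
      rw [le_div_iff₀ hbpos, mul_comm]
      exact (mul_le_mul_of_nonneg_right hx.2.le h3).trans h2
    rw [norm_mul, Real.norm_of_nonneg (likRatio_nonneg h.base_pos hm _ z), norm_neg]
    refine mul_le_mul h1 ?_ (norm_nonneg _) (by positivity)
    refine (norm_sum_le _ _).trans (Finset.sum_le_sum fun a _ => ?_)
    have := h.base_pos a
    have := hω a
    rw [norm_mul]
    refine mul_le_mul (hB' a x hx.1) ?_ (norm_nonneg _) hB
    rw [Real.norm_eq_abs, abs_le]
    constructor <;> linarith
  · exact (integrable_finsetSum _ fun a _ =>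
      ((h.integrable a).add (integrable_const _)).const_mul B).const_mul _
  · exact Eventually.of_forall fun ω x hx =>
      hasDerivAt_likRatio μ z (M ω) fun a => ht.hasDerivAt a x hx.1

/-- The derivative along the interpolation of the `z`-term of the expected log evidence. -/
noncomputable def logEvidenceDeriv (π : Measure Ω) (M : Ω → A → ℝ) (μ : A → ℝ)
    (t t' : A → ℝ → ℝ) (z : A → ℕ) (θ : ℝ) : ℝ :=
  prodPmf (fun a => t a θ) μ z * ∑ a, t' a θ *
    ((z a / t a θ - μ a) * Real.log (evidence π M μ (fun a => t a θ) z) -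
      (posteriorAvg π M μ (fun a => t a θ) z a - μ a))

lemma IsPositiveModel.hasDerivAt_prodPmf_mul_log_evidence (h : IsPositiveModel π M μ)
    (ht : IsInterpolation t t') {θ : ℝ} (hθ : θ ∈ Set.Ioo (0 : ℝ) 1)
    (hloc : ∀ a, t a θ = 0 → ∀ᶠ x in 𝓝 θ, t a x = 0) (z : A → ℕ) :
    HasDerivAt (fun x => prodPmf (fun a => t a x) μ z *
      Real.log (evidence π M μ (fun a => t a x) z)) (logEvidenceDeriv π M μ t t' z θ) θ := by
  have hθ' := Set.Ioo_subset_Icc_self hθ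
  by_cases hz : ∃ a, z a ≠ 0 ∧ t a θ = 0
  · obtain ⟨a, hza, hta⟩ := hz
    have e : logEvidenceDeriv π M μ t t' z θ = 0 := by
      rw [logEvidenceDeriv, prodPmf_eq_zero hza hta, zero_mul]
    rw [e]
    refine (hasDerivAt_const θ (0 : ℝ)).congr_of_eventuallyEq ?_
    filter_upwards [hloc a hta] with x hx
    rw [prodPmf_eq_zero hza hx, zero_mul]
  · push Not at hz
    have hP : 0 < prodPmf (fun a => t a θ) μ z := prodPmf_pos_of h.base_pos fun a ha =>
      (ht.nonneg a hθ').lt_of_ne' (hz a ha)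
    have hG := (h.evidence_pos (fun a => ht.nonneg a hθ') hP).ne'
    refine ((hasDerivAt_prodPmf μ z (fun a => ht.hasDerivAt a θ hθ') hz).mul
      ((h.hasDerivAt_evidence ht hθ hP).log hG)).congr_deriv ?_
    have e : logEvidenceDeriv π M μ t t' z θ = prodPmf (fun a => t a θ) μ z *
        ((∑ a, t' a θ * (z a / t a θ - μ a)) * Real.log (evidence π M μ (fun a => t a θ) z) -
          ∑ a, t' a θ * (posteriorAvg π M μ (fun a => t a θ) z a - μ a)) := by
      rw [logEvidenceDeriv, Finset.sum_mul, ← Finset.sum_sub_distrib]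
      congr 1
      exact Finset.sum_congr rfl fun a _ => by ring
    rw [e]
    field_simp
    ring

end Interpolation

section Bounds

variable {A Ω : Type*} [Fintype A] [MeasurableSpace Ω] {π : Measure Ω} [IsProbabilityMeasure π]
  {M : Ω → A → ℝ} {μ : A → ℝ}

lemma one_add_sum_le_two_pow (z : A → ℕ) : 1 + ∑ a, (z a : ℝ) ≤ 2 ^ ∑ a, z a := by
  have : 1 + ∑ a, z a ≤ 2 ^ ∑ a, z a := by
    rw [add_comm]; exact Nat.lt_two_pow_self
  exact_mod_cast this

lemma natCast_le_two_pow_sum (z : A → ℕ) (a : A) : (z a : ℝ) ≤ 2 ^ ∑ a, z a := by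
  have h1 := one_add_sum_le_two_pow z
  have h2 := Finset.single_le_sum (f := fun a => (z a : ℝ)) (fun a _ => Nat.cast_nonneg _)
    (Finset.mem_univ a)
  linarith

lemma prodPmf_le_sqrt {c m : A → ℝ} (hc : ∀ a, 0 ≤ c a) (hm : ∀ a, 0 ≤ m a) (z : A → ℕ) :
    prodPmf c m z ≤ √(prodPmf c m z) := by
  refine Real.le_sqrt_of_sq_le ?_
  have h0 := prodPmf_nonneg hc hm z
  have h1 := prodPmf_le_one hc hm z
  nlinarith

/-- Uniform summable domination of geometrically weighted square roots of the pmf. -/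
lemma exists_summable_pow_mul_sqrt_prodPmf_le (hμ : ∀ a, 0 ≤ μ a) {T q : ℝ} (hq : 0 ≤ q) :
    ∃ u : (A → ℕ) → ℝ, Summable u ∧ ∀ (c : A → ℝ) (z : A → ℕ), (∀ a, 0 ≤ c a) →
      (∀ a, c a ≤ T) → q ^ (∑ a, z a) * √(prodPmf c μ z) ≤ u z := by
  set R := √(∑ a, |T| * μ a) with hR
  have hR2 : R ^ 2 = ∑ a, |T| * μ a :=
    Real.sq_sqrt (Finset.sum_nonneg fun a _ => mul_nonneg (abs_nonneg T) (hμ a))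
  refine ⟨_, summable_prod_pow_div_sqrt_factorial (mul_nonneg hq (Real.sqrt_nonneg _) : 0 ≤ q * R),
    fun c z hc hcT => ?_⟩
  have h1 := sqrt_prodPmf_le hc hμ (Real.sqrt_nonneg _ : 0 ≤ R) (fun a => ?_) z
  · refine (mul_le_mul_of_nonneg_left h1 (pow_nonneg hq _)).trans_eq ?_
    rw [← Finset.prod_pow_eq_pow_sum, ← Finset.prod_mul_distrib]
    exact Finset.prod_congr rfl fun a _ => by rw [mul_pow, mul_div_assoc]
  · rw [hR2]
    refine (mul_le_mul_of_nonneg_right ((hcT a).trans (le_abs_self T)) (hμ a)).trans ?_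
    exact Finset.single_le_sum (f := fun a => |T| * μ a)
      (fun a _ => mul_nonneg (abs_nonneg T) (hμ a)) (Finset.mem_univ a)

lemma IsPositiveModel.exists_summable_prodPmf_mul_abs_log_evidence_le
    (h : IsPositiveModel π M μ) (T : ℝ) :
    ∃ u : (A → ℕ) → ℝ, Summable u ∧ ∀ (c : A → ℝ) (z : A → ℕ), (∀ a, 0 ≤ c a) →
      (∀ a, c a ≤ T) →
      2 ^ (∑ a, z a) * (prodPmf c μ z * |Real.log (evidence π M μ c z)|) ≤ u z := by
  obtain ⟨C, hC, hlow⟩ := h.exists_exp_le_evidence T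
  have hμ : ∀ a, 0 ≤ μ a := fun a => (h.base_pos a).le
  obtain ⟨u, hu, hle⟩ := exists_summable_pow_mul_sqrt_prodPmf_le hμ (T := T) zero_le_four
  refine ⟨fun z => (C + 2) * u z, hu.mul_left _, fun c z hc hcT => ?_⟩
  have h1 := h.prodPmf_mul_abs_log_evidence_le hc (K := C * (1 + ∑ a, (z a : ℝ)))
    (by positivity) (hlow c z hc hcT)
  have h2 := one_add_sum_le_two_pow z
  have h3 := prodPmf_le_sqrt hc hμ z
  have h4 := hle c z hc hcT
  have h5 : (1 : ℝ) ≤ 2 ^ ∑ a, z a := one_le_pow₀ one_le_two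
  rw [show (4 : ℝ) = 2 * 2 by norm_num, mul_pow] at h4
  set n := ∑ a, z a
  set P := prodPmf c μ z
  have hs := Real.sqrt_nonneg P
  have h6 : C * (1 + ∑ a, (z a : ℝ)) * P ≤ C * 2 ^ n * √P :=
    mul_le_mul (mul_le_mul_of_nonneg_left h2 hC) h3 (prodPmf_nonneg hc hμ z) (by positivity)
  have h7 : √P ≤ 2 ^ n * √P := le_mul_of_one_le_left hs h5
  calc _ ≤ 2 ^ n * ((C + 2) * (2 ^ n * √P)) :=
        mul_le_mul_of_nonneg_left (by linarith) (by positivity)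
    _ = (C + 2) * (2 ^ n * 2 ^ n * √P) := by ring
    _ ≤ _ := mul_le_mul_of_nonneg_left h4 (by linarith)

lemma IsPositiveModel.exists_summable_prodPmf_mul_posteriorAvg_le
    (h : IsPositiveModel π M μ) (T : ℝ) :
    ∃ u : (A → ℕ) → ℝ, Summable u ∧ ∀ (c : A → ℝ) (z : A → ℕ) (a : A) (δ : ℝ),
      (∀ a, 0 ≤ c a) → (∀ a, c a ≤ T) → 0 < prodPmf c μ z → 0 < δ → 2 * δ ≤ c a →
      δ * (prodPmf c μ z * posteriorAvg π M μ c z a) ≤ u z := by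
  obtain ⟨C, hC, hlow⟩ := h.exists_exp_le_evidence T
  have hμ : ∀ a, 0 ≤ μ a := fun a => (h.base_pos a).le
  obtain ⟨u, hu, hle⟩ := exists_summable_pow_mul_sqrt_prodPmf_le hμ (T := T) zero_le_two
  refine ⟨fun z => (C + 2) * u z, hu.mul_left _, fun c z a δ hc hcT hP hδ ha => ?_⟩
  have h1 := h.prodPmf_mul_posteriorAvg_le hc hP (hlow c z hc hcT hP) hδ ha
  have h2 := one_add_sum_le_two_pow z
  have h3 := prodPmf_le_sqrt hc hμ z
  have h4 := hle c z hc hcT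
  have h5 : (2 : ℝ) ^ z a ≤ 2 ^ ∑ a, z a := pow_le_pow_right₀ one_le_two
    (Finset.single_le_sum (fun _ _ => Nat.zero_le _) (Finset.mem_univ a))
  set n := ∑ a, z a
  set P := prodPmf c μ z
  have hs := Real.sqrt_nonneg P
  have h6 : C * (1 + ∑ a, (z a : ℝ)) * P ≤ C * 2 ^ n * √P :=
    mul_le_mul (mul_le_mul_of_nonneg_left h2 hC) h3 hP.le (by positivity)
  have h7 := mul_le_mul_of_nonneg_left h5 hs
  calc _ ≤ (C + 2) * (2 ^ n * √P) := by linarith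
    _ ≤ _ := mul_le_mul_of_nonneg_left h4 (by linarith)

lemma IsPositiveModel.summable_prodPmf_mul_abs_log_evidence (h : IsPositiveModel π M μ)
    {c : A → ℝ} (hc : ∀ a, 0 ≤ c a) :
    Summable fun z => 2 ^ (∑ a, z a) * (prodPmf c μ z * |Real.log (evidence π M μ c z)|) := by
  obtain ⟨u, hu, hle⟩ := h.exists_summable_prodPmf_mul_abs_log_evidence_le (∑ a, c a)
  exact hu.of_nonneg_of_le
    (fun z => mul_nonneg (by positivity)
      (mul_nonneg (prodPmf_nonneg hc (fun a => (h.base_pos a).le) z) (abs_nonneg _)))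
    fun z => hle c z hc fun a => Finset.single_le_sum (fun a _ => hc a) (Finset.mem_univ a)

lemma IsPositiveModel.summable_norm_prodPmf_mul_log_evidence (h : IsPositiveModel π M μ)
    {c : A → ℝ} (hc : ∀ a, 0 ≤ c a) :
    Summable fun z => ‖prodPmf c μ z * Real.log (evidence π M μ c z)‖ := by
  refine (h.summable_prodPmf_mul_abs_log_evidence hc).of_nonneg_of_le
    (fun z => norm_nonneg _) fun z => ?_
  have h0 := prodPmf_nonneg hc (fun a => (h.base_pos a).le) z
  rw [norm_mul, Real.norm_of_nonneg h0, Real.norm_eq_abs]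
  exact le_mul_of_one_le_left (mul_nonneg h0 (abs_nonneg _)) (one_le_pow₀ one_le_two)

/-- The expected log evidence is continuous along an interpolation. -/
lemma IsPositiveModel.continuousOn_tsum_prodPmf_mul_log_evidence (h : IsPositiveModel π M μ)
    {t t' : A → ℝ → ℝ} (ht : IsInterpolation t t') :
    ContinuousOn (fun θ => ∑' z, prodPmf (fun a => t a θ) μ z *
      Real.log (evidence π M μ (fun a => t a θ) z)) (Set.Icc 0 1) := by
  obtain ⟨T, -, hT⟩ := ht.exists_le
  obtain ⟨u, hu, hle⟩ := h.exists_summable_prodPmf_mul_abs_log_evidence_le T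
  refine continuousOn_tsum (fun z => h.continuousOn_prodPmf_mul_log_evidence ht z) hu
    fun z θ hθ => ?_
  have hc : ∀ a, 0 ≤ t a θ := fun a => ht.nonneg a hθ
  have h0 := prodPmf_nonneg hc (fun a => (h.base_pos a).le) z
  refine le_trans ?_ (hle _ z hc fun a => hT a θ hθ)
  rw [norm_mul, Real.norm_of_nonneg h0, Real.norm_eq_abs]
  exact le_mul_of_one_le_left (mul_nonneg h0 (abs_nonneg _)) (one_le_pow₀ one_le_two)

end Bounds

section Shift

variable {A Ω : Type*} [Fintype A] [MeasurableSpace Ω] {π : Measure Ω} [IsProbabilityMeasure π]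
  {M : Ω → A → ℝ} {μ c : A → ℝ} {z : A → ℕ}

omit [IsProbabilityMeasure π] in
lemma evidence_add_single [DecidableEq A] (μ c : A → ℝ) (z : A → ℕ) (a : A) :
    evidence π M μ c (z + Pi.single a 1) = (∫ ω, M ω a * likRatio μ c z (M ω) ∂π) / μ a := by
  unfold evidence
  rw [← integral_div]
  congr 1 with ω
  rw [likRatio_add_single]
  ring

lemma IsPositiveModel.log_evidence_add_single [DecidableEq A] (h : IsPositiveModel π M μ)
    (hc : ∀ a, 0 ≤ c a) (hP : 0 < prodPmf c μ z) {a : A} (ha : 0 < c a) :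
    Real.log (evidence π M μ c (z + Pi.single a 1)) =
      Real.log (evidence π M μ c z) + Real.log (posteriorAvg π M μ c z a / μ a) := by
  have hP' : 0 < prodPmf c μ (z + Pi.single a 1) := by
    have h1 := mul_prodPmf_add_single c μ z a
    have h2 := mul_pos (mul_pos ha (h.base_pos a)) hP
    exact pos_of_mul_pos_right (h1 ▸ h2) (by positivity)
  have hG := h.evidence_pos hc hP
  have hG' := h.evidence_pos hc hP'
  have hμ := h.base_pos a
  have e : evidence π M μ c (z + Pi.single a 1) =
      evidence π M μ c z * (posteriorAvg π M μ c z a / μ a) := by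
    rw [evidence_add_single]
    unfold posteriorAvg
    field_simp
  rw [e] at hG' ⊢
  exact Real.log_mul hG.ne' (pos_of_mul_pos_right hG' hG.le).ne'

/-- The Stein-type shift identity `E[Z f(Z)] = c μ E[f(Z + 1)]` for the log evidence. -/
lemma IsPositiveModel.hasSum_shift (h : IsPositiveModel π M μ) (hc : ∀ a, 0 ≤ c a) {a : A}
    (ha : 0 < c a) :
    HasSum (fun z => prodPmf c μ z * ((z a / c a - μ a) * Real.log (evidence π M μ c z) -
      μ a * Real.log (posteriorAvg π M μ c z a / μ a))) 0 := by
  classical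
  have hμ : ∀ a, 0 ≤ μ a := fun a => (h.base_pos a).le
  have hs : Summable fun z : A → ℕ =>
      (z a : ℝ) * (prodPmf c μ z * Real.log (evidence π M μ c z)) := by
    refine Summable.of_norm_bounded (h.summable_prodPmf_mul_abs_log_evidence hc) fun z => ?_
    rw [norm_mul, norm_mul, Real.norm_of_nonneg (prodPmf_nonneg hc hμ z), Real.norm_natCast,
      Real.norm_eq_abs]
    exact mul_le_mul_of_nonneg_right (natCast_le_two_pow_sum z a)
      (mul_nonneg (prodPmf_nonneg hc hμ z) (abs_nonneg _))
  have h1 := hs.hasSum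
  have hinj : Function.Injective fun z : A → ℕ => z + Pi.single a 1 := add_left_injective _
  rw [← hinj.hasSum_iff] at h1
  · have h2 : HasSum (fun z => c a * μ a * (prodPmf c μ z *
        (Real.log (evidence π M μ c z) + Real.log (posteriorAvg π M μ c z a / μ a))))
        (∑' z : A → ℕ, (z a : ℝ) * (prodPmf c μ z * Real.log (evidence π M μ c z))) := by
      refine h1.congr_fun fun z => ?_
      have e := mul_prodPmf_add_single c μ z a
      have e2 : (z + Pi.single a 1 : A → ℕ) a = z a + 1 := by simp
      rw [Function.comp_apply, e2, Nat.cast_add, Nat.cast_one, ← mul_assoc ((z a : ℝ) + 1), e]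
      rcases (prodPmf_nonneg hc hμ z).eq_or_lt with h0 | hP
      · rw [← h0]; ring
      · rw [h.log_evidence_add_single hc hP ha]; ring
    have h3 := (hs.hasSum.sub h2).mul_left (c a)⁻¹
    rw [sub_self, mul_zero] at h3
    refine h3.congr_fun fun z => ?_
    field_simp
    ring
  · intro z hz
    have : z a = 0 := by
      by_contra h0
      refine hz ⟨z - Pi.single a 1, funext fun b => ?_⟩
      rcases eq_or_ne b a with rfl | hb
      · simp; omega
      · simp [hb]
    rw [this]; simp

/-- The entropy loss of the posterior means, weighted by `w`. -/
noncomputable def posteriorLoss (π : Measure Ω) (M : Ω → A → ℝ) (μ w c : A → ℝ) (z : A → ℕ) : ℝ :=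
  ∑ a, w a * μ a * (posteriorAvg π M μ c z a / μ a - 1 - Real.log (posteriorAvg π M μ c z a / μ a))

lemma IsPositiveModel.hasSum_posteriorLoss (h : IsPositiveModel π M μ) {t t' : A → ℝ → ℝ} {θ : ℝ}
    (hc : ∀ a, 0 ≤ t a θ) (ht' : ∀ a, t' a θ = 0 ∨ 0 < t a θ)
    (hs : Summable fun z => logEvidenceDeriv π M μ t t' z θ) :
    HasSum (fun z => prodPmf (fun a => t a θ) μ z *
        posteriorLoss π M μ (fun a => t' a θ) (fun a => t a θ) z)
      (-∑' z, logEvidenceDeriv π M μ t t' z θ) := by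
  have h1 : HasSum (fun z => ∑ a, t' a θ * (prodPmf (fun a => t a θ) μ z *
      ((z a / t a θ - μ a) * Real.log (evidence π M μ (fun a => t a θ) z) -
        μ a * Real.log (posteriorAvg π M μ (fun a => t a θ) z a / μ a)))) (∑ _a : A, (0 : ℝ)) := by
    refine hasSum_sum fun a _ => ?_
    rcases ht' a with h0 | hpos
    · simp [h0]
    · simpa using (h.hasSum_shift hc hpos).mul_left (t' a θ)
  have h2 := h1.sub hs.hasSum
  rw [Finset.sum_const_zero, zero_sub] at h2
  refine h2.congr_fun fun z => ?_
  rw [posteriorLoss, logEvidenceDeriv, Finset.mul_sum, Finset.mul_sum, ← Finset.sum_sub_distrib]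
  refine Finset.sum_congr rfl fun a _ => ?_
  have := (h.base_pos a).ne'
  field_simp
  ring

end Shift

section Derivative

variable {A Ω : Type*} [Fintype A] [MeasurableSpace Ω] {π : Measure Ω} [IsProbabilityMeasure π]
  {M : Ω → A → ℝ} {μ : A → ℝ} {t t' : A → ℝ → ℝ}

/-- Last time at which component `a` of the interpolation vanishes. -/
noncomputable def activationTime (t : A → ℝ → ℝ) (a : A) : ℝ :=
  sSup {x | x ∈ Set.Icc (0 : ℝ) 1 ∧ t a x = 0}

omit [Fintype A] in
lemma IsInterpolation.eventually_eq_zero (ht : IsInterpolation t t') {a : A} {θ : ℝ}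
    (hθ : θ ∈ Set.Ioo (0 : ℝ) 1) (hne : θ ≠ activationTime t a) (h0 : t a θ = 0) :
    ∀ᶠ x in 𝓝 θ, t a x = 0 := by
  have hθ' := Set.Ioo_subset_Icc_self hθ
  have hb : BddAbove {x | x ∈ Set.Icc (0 : ℝ) 1 ∧ t a x = 0} := ⟨1, fun x hx => hx.1.2⟩
  have hlt : θ < activationTime t a := (le_csSup hb ⟨hθ', h0⟩).lt_of_ne hne
  have hn : {x | x ∈ Set.Icc (0 : ℝ) 1 ∧ t a x = 0}.Nonempty := ⟨θ, hθ', h0⟩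
  obtain ⟨y, hy, hy'⟩ := exists_lt_of_lt_csSup hn hlt
  filter_upwards [Ioo_mem_nhds hθ.1 hy'] with x hx
  have hx' : x ∈ Set.Icc (0 : ℝ) 1 := ⟨hx.1.le, hx.2.le.trans hy.1.2⟩
  exact le_antisymm (hy.2 ▸ ht.mono a hx' hy.1 hx.2.le) (ht.nonneg a hx')

lemma IsInterpolation.exists_eventually (ht : IsInterpolation t t') {θ : ℝ}
    (hθ : θ ∈ Set.Ioo (0 : ℝ) 1) (hne : ∀ a, θ ≠ activationTime t a) :
    ∃ δ : ℝ, 0 < δ ∧ ∀ᶠ x in 𝓝 θ, x ∈ Set.Ioo (0 : ℝ) 1 ∧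
      ∀ a, (t' a x = 0 ∧ ∀ᶠ y in 𝓝 x, t a y = 0) ∨ 2 * δ ≤ t a x := by
  have key : ∀ᶠ δ in 𝓝[>] (0 : ℝ), ∀ a, ∀ᶠ x in 𝓝 θ,
      (t' a x = 0 ∧ ∀ᶠ y in 𝓝 x, t a y = 0) ∨ 2 * δ ≤ t a x := by
    refine eventually_all.2 fun a => ?_
    have hθ' := Set.Ioo_subset_Icc_self hθ
    rcases (ht.nonneg a hθ').eq_or_lt with h0 | hpos
    · refine Eventually.of_forall fun δ => ?_
      filter_upwards [(ht.eventually_eq_zero hθ (hne a) h0.symm).eventually_nhds,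
        Icc_mem_nhds hθ.1 hθ.2] with x hx hx'
      exact Or.inl ⟨(ht.hasDerivAt a x hx').unique
        ((hasDerivAt_const x (0 : ℝ)).congr_of_eventuallyEq hx), hx⟩
    · filter_upwards [Ioo_mem_nhdsGT (show (0 : ℝ) < t a θ / 2 by linarith)] with δ hδ
      have : 2 * δ < t a θ := by linarith [hδ.2]
      filter_upwards [(ht.hasDerivAt a θ hθ').continuousAt.eventually_const_lt this] with x hx
      exact Or.inr hx.le
  obtain ⟨δ, hδ, hpos⟩ := (key.and self_mem_nhdsWithin).exists
  exact ⟨δ, hpos, Filter.inter_mem (Ioo_mem_nhds hθ.1 hθ.2) (eventually_all.2 hδ)⟩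

lemma IsPositiveModel.exists_summable_abs_logEvidenceDeriv_le (h : IsPositiveModel π M μ)
    (ht : IsInterpolation t t') {δ : ℝ} (hδ : 0 < δ) :
    ∃ u : (A → ℕ) → ℝ, Summable u ∧ ∀ θ ∈ Set.Icc (0 : ℝ) 1,
      (∀ a, t' a θ = 0 ∨ 2 * δ ≤ t a θ) → ∀ z, |logEvidenceDeriv π M μ t t' z θ| ≤ u z := by
  have hμ : ∀ a, 0 ≤ μ a := fun a => (h.base_pos a).le
  obtain ⟨T, -, hT⟩ := ht.exists_le
  obtain ⟨B, hB, hB'⟩ := ht.exists_abs_deriv_le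
  obtain ⟨u₁, hu₁, hle₁⟩ := h.exists_summable_prodPmf_mul_abs_log_evidence_le T
  obtain ⟨u₂, hu₂, hle₂⟩ := h.exists_summable_prodPmf_mul_posteriorAvg_le T
  obtain ⟨u₃, hu₃, hle₃⟩ := exists_summable_pow_mul_sqrt_prodPmf_le hμ (T := T) zero_le_one
  refine ⟨fun z => ∑ a, B * ((1 / (2 * δ) + μ a) * |u₁ z| + (1 / δ * |u₂ z| + μ a * |u₃ z|)),
    summable_sum fun a _ => ((hu₁.abs.mul_left _).add
      ((hu₂.abs.mul_left _).add (hu₃.abs.mul_left _))).mul_left B, fun θ hθ hact z => ?_⟩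
  have hc : ∀ a, 0 ≤ t a θ := fun a => ht.nonneg a hθ
  have hcT : ∀ a, t a θ ≤ T := fun a => hT a θ hθ
  unfold logEvidenceDeriv
  rw [Finset.mul_sum]
  refine (Finset.abs_sum_le_sum_abs _ _).trans (Finset.sum_le_sum fun a _ => ?_)
  have hμa := hμ a
  set P := prodPmf (fun a => t a θ) μ z with hPdef
  set L := Real.log (evidence π M μ (fun a => t a θ) z)
  set m := posteriorAvg π M μ (fun a => t a θ) z a
  have hrhs : 0 ≤ (1 / (2 * δ) + μ a) * |u₁ z| + (1 / δ * |u₂ z| + μ a * |u₃ z|) := by positivity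
  rcases hact a with h0 | hpos
  · rw [h0, zero_mul, mul_zero, abs_zero]
    exact mul_nonneg hB hrhs
  rcases (prodPmf_nonneg hc hμ z).eq_or_lt with h0 | hP
  · rw [hPdef, ← h0, zero_mul, abs_zero]
    exact mul_nonneg hB hrhs
  have hta : 0 < t a θ := by linarith
  have hm : 0 ≤ m := h.posteriorAvg_nonneg hc hP a
  have e : P * (t' a θ * ((z a / t a θ - μ a) * L - (m - μ a))) =
      t' a θ * ((z a / t a θ - μ a) * (P * L) - (P * m - μ a * P)) := by ring
  rw [e, abs_mul]
  refine mul_le_mul (hB' a θ hθ) ?_ (abs_nonneg _) hB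
  have b₁ := (hle₁ _ z hc hcT).trans (le_abs_self _)
  have b₂ := (hle₂ _ z a δ hc hcT hP hδ hpos).trans (le_abs_self _)
  have b₃ := (hle₃ _ z hc hcT).trans (le_abs_self _)
  rw [one_pow, one_mul] at b₃
  have b₄ : |P * m - μ a * P| ≤ 1 / δ * |u₂ z| + μ a * |u₃ z| := by
    have h1 : P * m ≤ 1 / δ * |u₂ z| := by
      rw [one_div, inv_mul_eq_div, le_div_iff₀ hδ, mul_comm]; exact b₂
    have h2 : μ a * P ≤ μ a * |u₃ z| :=
      mul_le_mul_of_nonneg_left ((prodPmf_le_sqrt hc hμ z).trans b₃) hμa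
    have h3 := mul_nonneg hP.le hm
    have h4 := mul_nonneg hμa hP.le
    rw [abs_le]; constructor <;> linarith
  have b₅ : |(z a / t a θ - μ a) * (P * L)| ≤ (1 / (2 * δ) + μ a) * |u₁ z| := by
    rw [abs_mul, abs_mul, abs_of_pos hP]
    have hPL : 0 ≤ P * |L| := mul_nonneg hP.le (abs_nonneg _)
    have h1 : |z a / t a θ - μ a| ≤ (1 / (2 * δ) + μ a) * 2 ^ ∑ a, z a := by
      have hz := natCast_le_two_pow_sum z a
      have h5 : (1 : ℝ) ≤ 2 ^ ∑ a, z a := one_le_pow₀ one_le_two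
      have h6 : (z a : ℝ) / t a θ ≤ 1 / (2 * δ) * 2 ^ ∑ a, z a := by
        rw [one_div, inv_mul_eq_div]
        exact div_le_div₀ (by positivity) hz (by positivity) hpos
      have h7 : 0 ≤ (z a : ℝ) / t a θ := by positivity
      have h8 : μ a ≤ μ a * 2 ^ ∑ a, z a := le_mul_of_one_le_right hμa h5
      rw [abs_le]; constructor <;> linarith
    calc _ ≤ (1 / (2 * δ) + μ a) * 2 ^ (∑ a, z a) * (P * |L|) :=
          mul_le_mul_of_nonneg_right h1 hPL
      _ = (1 / (2 * δ) + μ a) * (2 ^ (∑ a, z a) * (P * |L|)) := by ring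
      _ ≤ _ := mul_le_mul_of_nonneg_left b₁ (by positivity)
  exact (abs_sub _ _).trans (add_le_add b₅ b₄)

/-- Away from activation times, the expected log evidence decreases at the rate of the
entropy-loss risk of the posterior means. -/
lemma IsPositiveModel.hasDerivAt_tsum_prodPmf_mul_log_evidence (h : IsPositiveModel π M μ)
    (ht : IsInterpolation t t') {θ : ℝ} (hθ : θ ∈ Set.Ioo (0 : ℝ) 1)
    (hne : ∀ a, θ ≠ activationTime t a) :
    HasDerivAt (fun x => ∑' z, prodPmf (fun a => t a x) μ z *
        Real.log (evidence π M μ (fun a => t a x) z))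
      (-∑' z, prodPmf (fun a => t a θ) μ z *
        posteriorLoss π M μ (fun a => t' a θ) (fun a => t a θ) z) θ := by
  obtain ⟨δ, hδ, hev⟩ := ht.exists_eventually hθ hne
  obtain ⟨u, hu, hle⟩ := h.exists_summable_abs_logEvidenceDeriv_le ht hδ
  obtain ⟨ε, hε, hball⟩ := Metric.eventually_nhds_iff_ball.1 hev
  have hmem : θ ∈ Metric.ball θ ε := Metric.mem_ball_self hε
  have hIcc : ∀ x ∈ Metric.ball θ ε, x ∈ Set.Icc (0 : ℝ) 1 := fun x hx =>
    Set.Ioo_subset_Icc_self (hball x hx).1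
  have hbound : ∀ z, ∀ x ∈ Metric.ball θ ε, ‖logEvidenceDeriv π M μ t t' z x‖ ≤ u z :=
    fun z x hx => hle x (hIcc x hx) (fun a => ((hball x hx).2 a).imp_left And.left) z
  have hc : ∀ a, 0 ≤ t a θ := fun a => ht.nonneg a (hIcc θ hmem)
  have hD := hasDerivAt_tsum_of_isPreconnected hu Metric.isOpen_ball
    (convex_ball θ ε).isPreconnected (g := fun z x => prodPmf (fun a => t a x) μ z *
      Real.log (evidence π M μ (fun a => t a x) z))
    (g' := fun z x => logEvidenceDeriv π M μ t t' z x)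
    (fun z x hx => h.hasDerivAt_prodPmf_mul_log_evidence ht (hball x hx).1
      (fun a ha => ((hball x hx).2 a).elim And.right fun h2 => by linarith) z)
    hbound hmem (h.summable_norm_prodPmf_mul_log_evidence hc).of_norm hmem
  have hS := h.hasSum_posteriorLoss hc (t' := t')
    (fun a => ((hball θ hmem).2 a).imp And.left fun h2 => by linarith)
    (Summable.of_norm_bounded hu fun z => hbound z θ hmem)
  rwa [hS.tsum_eq, neg_neg]

/-- Integrating the entropy-loss risk along an interpolation. -/
theorem IsPositiveModel.integral_posteriorLoss (h : IsPositiveModel π M μ)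
    (ht : IsInterpolation t t')
    (hInt : IntervalIntegrable (fun θ => ∑' z, prodPmf (fun a => t a θ) μ z *
      posteriorLoss π M μ (fun a => t' a θ) (fun a => t a θ) z) volume 0 1) :
    ∫ θ in (0 : ℝ)..1, ∑' z, prodPmf (fun a => t a θ) μ z *
        posteriorLoss π M μ (fun a => t' a θ) (fun a => t a θ) z =
      ∑' z, prodPmf (fun a => t a 0) μ z * Real.log (evidence π M μ (fun a => t a 0) z) -
        ∑' z, prodPmf (fun a => t a 1) μ z * Real.log (evidence π M μ (fun a => t a 1) z) := by
  have := integral_eq_of_hasDerivAt_off_countable_of_le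
    (fun θ => -∑' z, prodPmf (fun a => t a θ) μ z *
      Real.log (evidence π M μ (fun a => t a θ) z)) _ zero_le_one
    (Set.countable_range (activationTime t))
    (h.continuousOn_tsum_prodPmf_mul_log_evidence ht).neg (fun θ hθ => ?_) hInt
  · rw [this]; ring
  · have hne : ∀ a, θ ≠ activationTime t a := fun a ha => hθ.2 ⟨a, ha.symm⟩
    simpa using (h.hasDerivAt_tsum_prodPmf_mul_log_evidence ht hθ.1 hne).fun_neg

end Derivative

section Predictive

variable {A Ω : Type*} [Fintype A] [MeasurableSpace Ω] {π : Measure Ω} [IsProbabilityMeasure π]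
  {M : Ω → A → ℝ} {μ r s : A → ℝ}

omit [IsProbabilityMeasure π] in
lemma integral_prodPmf (hμ : ∀ a, 0 < μ a) (c : A → ℝ) (z : A → ℕ) :
    ∫ ω, prodPmf c (M ω) z ∂π = prodPmf c μ z * evidence π M μ c z := by
  simp_rw [prodPmf_eq_mul_likRatio hμ c (M _) z]
  rw [integral_const_mul, evidence]

omit [IsProbabilityMeasure π] in
lemma integral_mul_prodPmf_div (hμ : ∀ a, 0 < μ a) {c : A → ℝ} {z : A → ℕ}
    (hP : prodPmf c μ z ≠ 0) (a : A) :
    (∫ ω, M ω a * prodPmf c (M ω) z ∂π) / ∫ ω, prodPmf c (M ω) z ∂π =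
      posteriorAvg π M μ c z a := by
  have e : ∀ ω, M ω a * prodPmf c (M ω) z =
      prodPmf c μ z * (M ω a * likRatio μ c z (M ω)) := fun ω => by
    rw [prodPmf_eq_mul_likRatio hμ c (M ω) z]; ring
  simp_rw [e]
  rw [integral_const_mul, integral_prodPmf hμ, mul_div_mul_left _ _ hP, posteriorAvg]

omit [IsProbabilityMeasure π] in
lemma integral_prodPmf_mul_prodPmf (hμ : ∀ a, 0 < μ a) (r s : A → ℝ) (x y : A → ℕ) :
    ∫ ω, prodPmf s (M ω) y * prodPmf r (M ω) x ∂π =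
      prodPmf s μ y * prodPmf r μ x *
        evidence π M μ (fun a => r a + s a) (fun a => x a + y a) := by
  have e : ∀ ω, prodPmf s (M ω) y * prodPmf r (M ω) x = prodPmf s μ y * prodPmf r μ x *
      likRatio μ (fun a => r a + s a) (fun a => x a + y a) (M ω) := fun ω => by
    rw [prodPmf_eq_mul_likRatio hμ s (M ω) y, prodPmf_eq_mul_likRatio hμ r (M ω) x,
      ← likRatio_mul_likRatio]
    ring
  simp_rw [e]
  rw [integral_const_mul, evidence]

lemma IsPositiveModel.prodPmf_mul_log_div_predictive (h : IsPositiveModel π M μ)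
    (hr : ∀ a, 0 ≤ r a) (hs : ∀ a, 0 ≤ s a) (x y : A → ℕ) :
    prodPmf r μ x * prodPmf s μ y * Real.log (prodPmf s μ y /
        ((∫ ω, prodPmf s (M ω) y * prodPmf r (M ω) x ∂π) / ∫ ω, prodPmf r (M ω) x ∂π)) =
      prodPmf r μ x * Real.log (evidence π M μ r x) * prodPmf s μ y -
        prodPmf r μ x * prodPmf s μ y *
          Real.log (evidence π M μ (fun a => r a + s a) (fun a => x a + y a)) := by
  have hμ : ∀ a, 0 ≤ μ a := fun a => (h.base_pos a).le
  rcases (prodPmf_nonneg hr hμ x).eq_or_lt with hx | hx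
  · rw [← hx]; ring
  rcases (prodPmf_nonneg hs hμ y).eq_or_lt with hy | hy
  · rw [← hy]; ring
  have hrs : ∀ a, 0 ≤ r a + s a := fun a => add_nonneg (hr a) (hs a)
  have hxy : 0 < prodPmf (fun a => r a + s a) μ (fun a => x a + y a) := by
    refine prodPmf_pos_of h.base_pos fun a ha => ?_
    refine (hrs a).lt_of_ne' fun h0 => ?_
    have hr0 : r a = 0 := by linarith [hr a, hs a]
    have hs0 : s a = 0 := by linarith [hr a, hs a]
    rcases Nat.eq_zero_or_pos (x a) with hx0 | hx0
    · exact hy.ne' (prodPmf_eq_zero (by omega) hs0)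
    · exact hx.ne' (prodPmf_eq_zero hx0.ne' hr0)
  have hGx := h.evidence_pos hr hx
  have hGxy := h.evidence_pos hrs hxy
  rw [integral_prodPmf_mul_prodPmf h.base_pos, integral_prodPmf h.base_pos]
  have e : prodPmf s μ y / (prodPmf s μ y * prodPmf r μ x *
      evidence π M μ (fun a => r a + s a) (fun a => x a + y a) /
        (prodPmf r μ x * evidence π M μ r x)) =
      evidence π M μ r x / evidence π M μ (fun a => r a + s a) (fun a => x a + y a) := by
    field_simp
  rw [e, Real.log_div hGx.ne' hGxy.ne']
  ring

/-- The Kullback–Leibler risk is the difference of the expected log evidences. -/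
theorem IsPositiveModel.tsum_prodPmf_mul_log_div_predictive (h : IsPositiveModel π M μ)
    (hr : ∀ a, 0 ≤ r a) (hs : ∀ a, 0 ≤ s a)
    (hsum : Summable fun p : (A → ℕ) × (A → ℕ) =>
      prodPmf r μ p.1 * prodPmf s μ p.2 * Real.log (prodPmf s μ p.2 /
        ((∫ ω, prodPmf s (M ω) p.2 * prodPmf r (M ω) p.1 ∂π) / ∫ ω, prodPmf r (M ω) p.1 ∂π))) :
    ∑' p : (A → ℕ) × (A → ℕ),
      prodPmf r μ p.1 * prodPmf s μ p.2 * Real.log (prodPmf s μ p.2 /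
        ((∫ ω, prodPmf s (M ω) p.2 * prodPmf r (M ω) p.1 ∂π) / ∫ ω, prodPmf r (M ω) p.1 ∂π)) =
      ∑' z, prodPmf r μ z * Real.log (evidence π M μ r z) -
        ∑' z, prodPmf (fun a => r a + s a) μ z *
          Real.log (evidence π M μ (fun a => r a + s a) z) := by
  have hμ : ∀ a, 0 ≤ μ a := fun a => (h.base_pos a).le
  simp only [h.prodPmf_mul_log_div_predictive hr hs] at hsum ⊢
  have hns := h.summable_norm_prodPmf_mul_log_evidence hr
  have hone := hasSum_prodPmf hs hμ
  have h1 : HasSum (fun p : (A → ℕ) × (A → ℕ) =>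
      prodPmf r μ p.1 * Real.log (evidence π M μ r p.1) * prodPmf s μ p.2)
      (∑' z, prodPmf r μ z * Real.log (evidence π M μ r z)) := by
    have := hns.of_norm.hasSum.mul hone (summable_mul_of_summable_norm hns hone.summable.norm)
    rwa [mul_one] at this
  have h2 : Summable fun p : (A → ℕ) × (A → ℕ) => prodPmf r μ p.1 * prodPmf s μ p.2 *
      Real.log (evidence π M μ (fun a => r a + s a) (fun a => p.1 a + p.2 a)) :=
    (h1.summable.sub hsum).congr fun p => by ring
  rw [h1.summable.tsum_sub h2, h1.tsum_eq, tsum_prodPmf_mul_prodPmf r s μ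
    (fun z => Real.log (evidence π M μ (fun a => r a + s a) z)) h2]

end Predictive

section Hierarchy

variable {n : ℕ → ℕ} {D : ℕ}

/-- All indices of the hierarchy, at every level. -/
abbrev Node (n : ℕ → ℕ) (D : ℕ) := (d : Fin (D + 1)) × Idx n d.val

/-- The means attached to all the nodes by a bottom-level parameter. -/
noncomputable def nodeMean (n : ℕ → ℕ) (D : ℕ) (l : Idx n D → ℝ) (a : Node n D) : ℝ :=
  marg n D l (Nat.lt_succ_iff.mp a.1.isLt) a.2

/-- Observations as functions on nodes. -/
def obsEquiv (n : ℕ → ℕ) (D : ℕ) : Obs n D ≃ (Node n D → ℕ) :=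
  (Equiv.piCurry fun _ _ => ℕ).symm

lemma scaledPmf_eq_prodPmf (c : (d : Fin (D + 1)) → Idx n d.val → ℝ) (l : Idx n D → ℝ)
    (z : Obs n D) :
    scaledPmf n D c l z = prodPmf (fun a => c a.1 a.2) (nodeMean n D l) (obsEquiv n D z) :=
  (Fintype.prod_sigma' fun (d : Fin (D + 1)) (i : Idx n d.val) =>
    poissonPmf (c d i * marg n D l (Nat.lt_succ_iff.mp d.isLt) i) (z d i)).symm

lemma exists_resIdx_eq (hn : ∀ d, 1 ≤ d → d ≤ D → 1 ≤ n d) {d : ℕ} (h : d ≤ D) (i : Idx n d) :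
    ∃ j : Idx n D, resIdx n h j = i := by
  refine ⟨fun k => if hk : k.val < d then i ⟨k.val, hk⟩ else
    ⟨0, hn (k.val + 1) (by omega) (by omega)⟩, funext fun k => ?_⟩
  simp [resIdx]

lemma marg_pos (hn : ∀ d, 1 ≤ d → d ≤ D → 1 ≤ n d) {l : Idx n D → ℝ} (hl : ∀ j, 0 < l j)
    {d : ℕ} (h : d ≤ D) (i : Idx n d) : 0 < marg n D l h i := by
  obtain ⟨j, hj⟩ := exists_resIdx_eq hn h i
  refine Finset.sum_pos' (fun j _ => ?_) ⟨j, Finset.mem_univ j, by rw [if_pos hj]; exact hl j⟩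
  split_ifs
  exacts [(hl j).le, le_rfl]

lemma isPositiveModel_nodeMean (hn : ∀ d, 1 ≤ d → d ≤ D → 1 ≤ n d) {lam : Idx n D → ℝ}
    (hlam : ∀ j, 0 < lam j) {π : Measure (Idx n D → ℝ)}
    (hpos : π {l : Idx n D → ℝ | ∀ j, 0 < l j}ᶜ = 0)
    (hint : ∀ j : Idx n D, Integrable (fun l : Idx n D → ℝ => l j) π) :
    IsPositiveModel π (nodeMean n D) (nodeMean n D lam) where
  measurable a := by
    refine Finset.measurable_sum _ fun j _ => ?_
    split_ifs
    exacts [measurable_pi_apply j, measurable_const]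
  pos := by
    filter_upwards [mem_ae_iff.2 hpos] with l hl a
    exact marg_pos hn hl _ _
  integrable a := by
    refine integrable_finsetSum _ fun j _ => ?_
    split_ifs
    exacts [hint j, integrable_zero _ _ _]
  base_pos a := marg_pos hn hlam _ _

lemma predDens_eq (π : Measure (Idx n D → ℝ)) (r s : (d : Fin (D + 1)) → Idx n d.val → ℝ)
    (x y : Obs n D) :
    predDens n D π r s x y =
      (∫ l, prodPmf (fun a : Node n D => s a.1 a.2) (nodeMean n D l) (obsEquiv n D y) *
        prodPmf (fun a : Node n D => r a.1 a.2) (nodeMean n D l) (obsEquiv n D x) ∂π) /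
        ∫ l, prodPmf (fun a : Node n D => r a.1 a.2) (nodeMean n D l) (obsEquiv n D x) ∂π := by
  simp only [predDens, scaledPmf_eq_prodPmf]

lemma thetaRisk_eq {lam : Idx n D → ℝ} {π : Measure (Idx n D → ℝ)}
    (h : IsPositiveModel π (nodeMean n D) (nodeMean n D lam))
    (t t' : (d : Fin (D + 1)) → Idx n d.val → ℝ → ℝ) (θ : ℝ) :
    thetaRisk n D π lam t t' θ = ∑' z : Node n D → ℕ,
      prodPmf (fun a => t a.1 a.2 θ) (nodeMean n D lam) z *
        posteriorLoss π (nodeMean n D) (nodeMean n D lam) (fun a => t' a.1 a.2 θ)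
          (fun a => t a.1 a.2 θ) z := by
  rw [← (obsEquiv n D).tsum_eq]
  refine tsum_congr fun z => ?_
  rw [scaledPmf_eq_prodPmf]
  rcases eq_or_ne (prodPmf (fun a : Node n D => t a.1 a.2 θ) (nodeMean n D lam)
    (obsEquiv n D z)) 0 with h0 | hP
  · rw [h0, zero_mul, zero_mul]
  congr 1
  have hpost : ∀ (d : Fin (D + 1)) (i : Idx n d.val),
      postMean n D π (fun d i => t d i θ) z d i = posteriorAvg π (nodeMean n D) (nodeMean n D lam)
        (fun a => t a.1 a.2 θ) (obsEquiv n D z) ⟨d, i⟩ := fun d i => by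
    rw [← integral_mul_prodPmf_div h.base_pos hP]
    simp only [postMean, scaledPmf_eq_prodPmf]
    rfl
  simp only [hpost]
  rw [posteriorLoss, Fintype.sum_sigma]
  rfl

end Hierarchy

end PoissonPrediction

/- STATEMENT 19: the Kullback–Leibler risk of the Bayesian predictive density equals the
integral over θ ∈ [0,1] of the entropy-loss risks of the posterior-mean estimators,
assuming all expectations involved are finite (summability/integrability hypotheses). -/
theorem stmt_19 (D : ℕ) (hD : 1 ≤ D) (n : ℕ → ℕ)
    (hn : ∀ d, 1 ≤ d → d ≤ D → 1 ≤ n d)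
    (lam : Idx n D → ℝ) (hlam : ∀ j, 0 < lam j)
    (r s : (d : Fin (D + 1)) → Idx n d.val → ℝ)
    (hr : ∀ d i, 0 ≤ r d i) (hs : ∀ d i, 0 ≤ s d i)
    (π : MeasureTheory.Measure (Idx n D → ℝ)) [MeasureTheory.IsProbabilityMeasure π]
    (hπpos : π {l : Idx n D → ℝ | ∀ j, 0 < l j}ᶜ = 0)
    (hπint : ∀ j : Idx n D, MeasureTheory.Integrable (fun l : Idx n D → ℝ => l j) π)
    (t t' : (d : Fin (D + 1)) → Idx n d.val → ℝ → ℝ)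
    (ht0 : ∀ d i, t d i 0 = r d i)
    (ht1 : ∀ d i, t d i 1 = s d i + r d i)
    (hmono : ∀ d i, MonotoneOn (t d i) (Set.Icc 0 1))
    (hderiv : ∀ d i, ∀ θ ∈ Set.Icc (0 : ℝ) 1, HasDerivAt (t d i) (t' d i θ) θ)
    (hcont : ∀ d i, ContinuousOn (t' d i) (Set.Icc 0 1))
    (hsumKL : Summable (fun p : Obs n D × Obs n D =>
      scaledPmf n D r lam p.1 * scaledPmf n D s lam p.2 *
        Real.log (scaledPmf n D s lam p.2 / predDens n D π r s p.1 p.2)))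
    (hsumθ : ∀ θ ∈ Set.Icc (0 : ℝ) 1, Summable (fun z : Obs n D =>
      scaledPmf n D (fun d i => t d i θ) lam z *
        ∑ d : Fin (D + 1), ∑ i : Idx n d.val,
          t' d i θ * marg n D lam (Nat.lt_succ_iff.mp d.isLt) i *
            (postMean n D π (fun d' i' => t d' i' θ) z d i /
                marg n D lam (Nat.lt_succ_iff.mp d.isLt) i - 1 -
              Real.log (postMean n D π (fun d' i' => t d' i' θ) z d i /
                marg n D lam (Nat.lt_succ_iff.mp d.isLt) i))))
    (hInt : IntervalIntegrable (thetaRisk n D π lam t t') MeasureTheory.volume 0 1) :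
    ∑' p : Obs n D × Obs n D,
        scaledPmf n D r lam p.1 * scaledPmf n D s lam p.2 *
          Real.log (scaledPmf n D s lam p.2 / predDens n D π r s p.1 p.2) =
      ∫ θ in (0 : ℝ)..1, thetaRisk n D π lam t t' θ := by
  have h := PoissonPrediction.isPositiveModel_nodeMean hn hlam hπpos hπint
  have ht : PoissonPrediction.IsInterpolation
      (fun (a : PoissonPrediction.Node n D) θ => t a.1 a.2 θ) (fun a θ => t' a.1 a.2 θ) :=
    ⟨fun a => (ht0 a.1 a.2).symm ▸ hr a.1 a.2, fun a => hmono a.1 a.2,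
      fun a => hderiv a.1 a.2, fun a => hcont a.1 a.2⟩
  have hrisk := funext (PoissonPrediction.thetaRisk_eq h t t')
  let e := (PoissonPrediction.obsEquiv n D).prodCongr (PoissonPrediction.obsEquiv n D)
  simp only [PoissonPrediction.predDens_eq, PoissonPrediction.scaledPmf_eq_prodPmf] at hsumKL ⊢
  rw [hrisk] at hInt ⊢
  have hKL := h.tsum_prodPmf_mul_log_div_predictive (fun a => hr a.1 a.2) (fun a => hs a.1 a.2)
    (e.summable_iff.1 hsumKL)
  rw [h.integral_posteriorLoss ht hInt]
  simp only [ht0, ht1, add_comm (s _ _)]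
  rw [← hKL, ← e.tsum_eq]
  rfl
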